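/- arXiv:1007.0514 — 5 statements merged into one kernel-verified Lean document; each statement's English description precedes it below -/
import Mathlib

section
/- Suppose the support of X coincides with (a,b). (1) If g(x) ≥ α x² + β x + γ for almost every x ∈ (a,b), then Var[X] ≥ γ/(1−α) = Var[Z]. (2) If instead g(x) ≤ α x² + β x + γ for almost every x ∈ (a,b), then Var[X] ≤ γ/(1−α) = Var[Z]. -/
open MeasureTheory Filter Set

/-- Fubini for the tail integrals of `f` over a half-line. -/
theorem integral_Ioi_integral_Ioi {f : ℝ → ℝ} (hf : Integrable f)
    (hyf : Integrable fun y => y * f y) (c : ℝ) :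
    IntegrableOn (fun x => ∫ y in Ioi x, f y) (Ioi c) ∧
      ∫ x in Ioi c, ∫ y in Ioi x, f y = ∫ y in Ioi c, (y - c) * f y := by
  set ν : Measure ℝ := volume.restrict (Ioi c) with hν
  set F : ℝ × ℝ → ℝ := {p : ℝ × ℝ | p.1 < p.2}.indicator (fun p => f p.2) with hF
  have hFxy : ∀ x y, F (x, y) = (Iio y).indicator (fun _ => f y) x := fun x y => by
    simp [hF, indicator]
  have hFyx : ∀ x y, F (x, y) = (Ioi x).indicator f y := fun x y => by
    simp [hF, indicator]
  have hmeas : AEStronglyMeasurable F (ν.prod ν) :=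
    (hf.1.restrict.comp_snd).indicator (measurableSet_lt measurable_fst measurable_snd)
  have hfin : ∀ y, ν (Iio y) ≠ ⊤ := fun y => by
    rw [hν, Measure.restrict_apply measurableSet_Iio, inter_comm, Ioi_inter_Iio]
    simp
  have hν_real : ∀ y, c < y → ν.real (Iio y) = y - c := fun y hy => by
    rw [hν, measureReal_restrict_apply measurableSet_Iio, inter_comm, Ioi_inter_Iio]
    simp [hy.le]
  have hshift : Integrable (fun y => (y - c) * f y) := by
    simp only [sub_mul]
    exact hyf.sub (hf.const_mul c)
  have hinner : ∀ y, c < y → ∫ x, F (x, y) ∂ν = (y - c) * f y := fun y hy => by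
    simp_rw [hFxy]
    rw [integral_indicator_const _ measurableSet_Iio, hν_real y hy, smul_eq_mul]
  have hnorm : ∀ y, c < y → ∫ x, ‖F (x, y)‖ ∂ν = ‖(y - c) * f y‖ := fun y hy => by
    simp_rw [hFxy, norm_indicator_eq_indicator_norm]
    rw [integral_indicator_const _ measurableSet_Iio, hν_real y hy, smul_eq_mul, norm_mul,
      Real.norm_of_nonneg (sub_pos.2 hy).le]
  have hint : Integrable F (ν.prod ν) := by
    rw [integrable_prod_iff' hmeas]
    refine ⟨Eventually.of_forall fun y => ?_, ?_⟩
    · simp_rw [hFxy]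
      exact (integrableOn_const (hfin y)).integrable_indicator measurableSet_Iio
    · refine hshift.norm.restrict.congr ?_
      filter_upwards [ae_restrict_mem measurableSet_Ioi] with y hy using (hnorm y hy).symm
  have htail : ∀ x, c < x → ∫ y, F (x, y) ∂ν = ∫ y in Ioi x, f y := fun x hx => by
    simp_rw [hFyx]
    rw [integral_indicator measurableSet_Ioi, hν, Measure.restrict_restrict measurableSet_Ioi,
      Ioi_inter_Ioi, sup_eq_left.2 hx.le]
  refine ⟨hint.integral_prod_left.congr ?_, ?_⟩
  · filter_upwards [ae_restrict_mem measurableSet_Ioi] with x hx using htail x hx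
  · rw [← setIntegral_congr_fun measurableSet_Ioi htail,
      ← setIntegral_congr_fun measurableSet_Ioi hinner]
    exact integral_integral_swap (f := fun x y => F (x, y)) hint

theorem integral_Ioi_eq_sub {f : ℝ → ℝ} (hf : Integrable f) (x c : ℝ) :
    ∫ y in Ioi x, f y = (∫ y in Ioi c, f y) - ∫ y in c..x, f y := by
  rw [← intervalIntegral.integral_Ioi_sub_Ioi' hf.integrableOn hf.integrableOn]
  ring

theorem continuous_integral_Ioi {f : ℝ → ℝ} (hf : Integrable f) :
    Continuous fun x => ∫ y in Ioi x, f y := by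
  rw [funext fun x => integral_Ioi_eq_sub hf x 0]
  exact continuous_const.sub
    (intervalIntegral.continuous_primitive (fun _ _ => hf.intervalIntegrable) 0)

theorem hasDerivAt_integral_Ioi {f : ℝ → ℝ} (hf : Integrable f) (hc : Continuous f) (x : ℝ) :
    HasDerivAt (fun x => ∫ y in Ioi x, f y) (-f x) x := by
  rw [funext fun x => integral_Ioi_eq_sub hf x 0]
  exact (hc.integral_hasStrictDerivAt 0 x).hasDerivAt.const_sub _

/-- At a finite right endpoint of its support, the Stein factor of a continuous Pearson density
vanishes, and it is positive before that endpoint. -/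
theorem pearson_pos_and_eq_zero {α β γ b : ℝ} (hb : 0 < b) {ρ : ℝ → ℝ} (hc : Continuous ρ)
    (hpos : ∀ x, 0 < x → (0 < ρ x ↔ x < b)) (hmom : Integrable fun y => y * ρ y)
    (hP : ∀ x, 0 < x → x < b →
      ∫ y in Ioi x, y * ρ y = (α * x ^ 2 + β * x + γ) * ρ x) :
    (∀ x, 0 < x → x < b → 0 < α * x ^ 2 + β * x + γ) ∧ α * b ^ 2 + β * b + γ = 0 := by
  set q : ℝ → ℝ := fun x => α * x ^ 2 + β * x + γ with hq
  set P : ℝ → ℝ := fun x => ∫ y in Ioi x, y * ρ y with hPdef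
  have hqc : Continuous q := by fun_prop
  have hPc : Continuous P := continuous_integral_Ioi hmom
  have hlim : ∀ {h : ℝ → ℝ}, Continuous h → Tendsto h (nhdsWithin b (Iio b)) (nhds (h b)) :=
    fun hh => hh.continuousAt.continuousWithinAt
  have hmem : ∀ᶠ x in nhdsWithin b (Iio b), 0 < x ∧ x < b :=
    Ioo_mem_nhdsLT hb
  have hρb : ρ b = 0 := by
    refine le_antisymm (not_lt.1 fun h => lt_irrefl b ((hpos b hb).1 h)) ?_
    exact ge_of_tendsto (hlim hc) (hmem.mono fun x hx => ((hpos x hx.1).2 hx.2).le)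
  have hPb : P b = 0 := by
    have h := (hlim hPc).congr' (hmem.mono fun x hx => hP x hx.1 hx.2)
    have h' := tendsto_nhds_unique h (hlim (hqc.mul hc))
    simpa [hρb] using h'
  have hPpos : ∀ x, 0 < x → x < b → 0 < P x := by
    intro x hx hxb
    have h := integral_Ioi_eq_sub hmom x b
    rw [show (∫ y in Ioi b, y * ρ y) = 0 from hPb, zero_sub,
      ← intervalIntegral.integral_symm] at h
    rw [hPdef]
    simp only [h]
    refine intervalIntegral.intervalIntegral_pos_of_pos_on hmom.intervalIntegrable ?_ hxb
    intro y hy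
    exact mul_pos (hx.trans hy.1) ((hpos y (hx.trans hy.1)).2 hy.2)
  have hqpos : ∀ x, 0 < x → x < b → 0 < q x := by
    intro x hx hxb
    have h := hPpos x hx hxb
    rw [show P x = q x * ρ x from hP x hx hxb] at h
    exact pos_of_mul_pos_left h ((hpos x hx).2 hxb).le
  refine ⟨hqpos, ?_⟩
  have hqb : 0 ≤ q b := ge_of_tendsto (hlim hqc) (hmem.mono fun x hx => (hqpos x hx.1 hx.2).le)
  by_contra hne
  have hqb' : 0 < q b := lt_of_le_of_ne hqb (Ne.symm hne)
  obtain ⟨m, hm, hmin⟩ := (isCompact_Icc (a := b / 2) (b := b)).exists_isMinOn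
    (nonempty_Icc.2 (by linarith)) hqc.continuousOn
  have hqm : 0 < q m := by
    rcases hm.2.lt_or_eq with h | h
    · exact hqpos m (by linarith [hm.1]) h
    · rwa [h]
  set K : ℝ := b / q m with hK
  have hderiv : ∀ x, HasDerivAt (fun x => P x * Real.exp (K * x))
      (-(x * ρ x) * Real.exp (K * x) + P x * (Real.exp (K * x) * K)) x := by
    intro x
    have h1 := hasDerivAt_integral_Ioi hmom (continuous_id.mul hc) x
    have h2 : HasDerivAt (fun x => Real.exp (K * x)) (Real.exp (K * x) * K) x := by
      simpa using ((hasDerivAt_id x).const_mul K).exp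
    exact h1.mul h2
  have hmono : MonotoneOn (fun x => P x * Real.exp (K * x)) (Icc (b / 2) b) := by
    refine monotoneOn_of_hasDerivWithinAt_nonneg (convex_Icc _ _)
      (fun x _ => (hderiv x).continuousAt.continuousWithinAt)
      (fun x _ => (hderiv x).hasDerivWithinAt) ?_
    intro x hx
    rw [interior_Icc] at hx
    have hx0 : 0 < x := by linarith [hx.1]
    have hρx := (hpos x hx0).2 hx.2
    have hqx : q m ≤ q x := hmin (Ioo_subset_Icc_self hx)
    have hKq : b ≤ K * q x := by
      rw [hK, div_mul_eq_mul_div, le_div_iff₀ hqm]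
      gcongr
    have : -(x * ρ x) * Real.exp (K * x) + P x * (Real.exp (K * x) * K)
        = (K * q x - x) * ρ x * Real.exp (K * x) := by
      rw [show P x = q x * ρ x from hP x hx0 hx.2]
      ring
    rw [this]
    have : 0 ≤ K * q x - x := by linarith [hx.2]
    positivity
  have hle := hmono (left_mem_Icc.2 (by linarith)) (right_mem_Icc.2 (by linarith))
    (show b / 2 ≤ b by linarith)
  simp only [hPb, zero_mul] at hle
  exact absurd hle (not_le.2 (mul_pos (hPpos _ (by linarith) (by linarith)) (Real.exp_pos _)))

/-- Beyond a finite right endpoint, the Stein factor of a Pearson density is at most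
`y * (y - b)`. -/
theorem pearson_le_mul_sub {α β γ b : ℝ} (hα : α < 1) (hb : 0 < b)
    (hq : ∀ x, 0 < x → x < b → 0 < α * x ^ 2 + β * x + γ) (hqb : α * b ^ 2 + β * b + γ = 0)
    {y : ℝ} (hy : b < y) : α * y ^ 2 + β * y + γ ≤ y * (y - b) := by
  have hfac : ∀ x, α * x ^ 2 + β * x + γ = (x - b) * (α * (x + b) + β) := fun x => by
    linear_combination hqb
  have hslope : α * (b + b) + β ≤ 0 := by
    have hlim : Tendsto (fun x => α * (x + b) + β) (nhdsWithin b (Iio b))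
        (nhds (α * (b + b) + β)) :=
      (show Continuous fun x => α * (x + b) + β by fun_prop).continuousAt.continuousWithinAt
    refine le_of_tendsto hlim (Filter.mem_of_superset (Ioo_mem_nhdsLT hb) fun x hx => ?_)
    have h := hq x hx.1 hx.2
    rw [hfac] at h
    exact (neg_of_mul_pos_right h (by linarith [hx.2])).le
  rw [hfac, mul_comm y]
  have hα' : α * (y - b) ≤ y - b := by nlinarith
  exact mul_le_mul_of_nonneg_left (by linarith) (by linarith)

/-- If the tail moment dominates `q * ρ` on `(0, b)`, then `ρ` puts no mass beyond `b`, and the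
domination holds on the whole half-line. -/
theorem ae_mul_le_integral_Ioi {q : ℝ → ℝ} {b : ℝ} (hb : 0 < b)
    (hq : ∀ x, 0 < x → x < b → 0 < q x) {ρ : ℝ → ℝ}
    (hpos : ∀ x, 0 < x → (0 < ρ x ↔ x < b)) (hmom : Integrable fun y => y * ρ y)
    (h : ∀ᵐ x, 0 < x → x < b → q x * ρ x ≤ ∫ y in Ioi x, y * ρ y) :
    ∀ᵐ x, 0 < x → q x * ρ x ≤ ∫ y in Ioi x, y * ρ y := by
  have hnonpos : ∀ y, b < y → y * ρ y ≤ 0 := fun y hy =>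
    mul_nonpos_of_nonneg_of_nonpos (hb.trans hy).le
      (not_lt.1 fun h => hy.not_gt ((hpos y (hb.trans hy)).1 h))
  have hPb : 0 ≤ ∫ y in Ioi b, y * ρ y := by
    by_contra! hneg
    have hev : ∀ᶠ x in nhds b, ∫ y in Ioi x, y * ρ y < 0 :=
      (continuous_integral_Ioi hmom).continuousAt.eventually_lt_const hneg
    obtain ⟨l, hl, hlb⟩ := (mem_nhdsLE_iff_exists_Ioc_subset.1
      (mem_nhdsWithin_of_mem_nhds hev) : ∃ l ∈ Iio b, Ioc l b ⊆ _)
    have hfreq : volume (Ioo (max l 0) b) ≠ 0 := by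
      rw [Real.volume_Ioo]
      simpa using ⟨hl, hb⟩
    refine hfreq (measure_mono_null ?_ (ae_iff.1 h))
    intro x hx hcon
    have hx0 : 0 < x := (le_max_right _ _).trans_lt hx.1
    have h1 := hcon hx0 hx.2
    have h2 : ∫ y in Ioi x, y * ρ y < 0 := hlb ⟨(le_max_left _ _).trans_lt hx.1, hx.2.le⟩
    have h3 := mul_pos (hq x hx0 hx.2) ((hpos x hx0).2 hx.2)
    linarith
  have hzero : ∀ᵐ y, b < y → y * ρ y = 0 := by
    have h0 : ∫ y in Ioi b, -(y * ρ y) = 0 := by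
      rw [integral_neg, neg_eq_zero]
      exact le_antisymm (setIntegral_nonpos measurableSet_Ioi hnonpos) hPb
    have hnn : 0 ≤ᵐ[volume.restrict (Ioi b)] fun y => -(y * ρ y) := by
      filter_upwards [ae_restrict_mem measurableSet_Ioi] with y hy
      exact neg_nonneg.2 (hnonpos y hy)
    have h1 := (integral_eq_zero_iff_of_nonneg_ae hnn hmom.neg.restrict).1 h0
    filter_upwards [(ae_restrict_iff' measurableSet_Ioi).1 h1] with y hy hby
    simpa using hy hby
  filter_upwards [h, hzero, Measure.ae_ne volume b] with x hx hx' hxb hx0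
  rcases lt_or_gt_of_ne hxb with hlt | hgt
  · exact hx hx0 hlt
  · have hρ : ρ x = 0 := (mul_eq_zero.1 (hx' hgt)).resolve_left hx0.ne'
    have hint : ∫ y in Ioi x, y * ρ y = 0 := by
      refine integral_eq_zero_of_ae ((ae_restrict_iff' measurableSet_Ioi).2 ?_)
      filter_upwards [hzero] with y hy hxy using hy (hgt.trans hxy)
    simp [hρ, hint]

theorem integrable_quadratic_mul {ρ : ℝ → ℝ} (hint : Integrable ρ)
    (hmom : Integrable fun y => y * ρ y) (hsq : Integrable fun y => y ^ 2 * ρ y) (α β γ : ℝ) :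
    Integrable fun y => (α * y ^ 2 + β * y + γ) * ρ y := by
  refine (((hsq.const_mul α).add (hmom.const_mul β)).add (hint.const_mul γ)).congr ?_
  exact Eventually.of_forall fun y => by simp only [Pi.add_apply]; ring

/-- One-sided comparison of a density `ρ` with a Pearson density `ρZ` on the positive half-line,
when both have the same right endpoint `b` of their support. -/
theorem integral_Ioi_sq_mul_comparison {α β γ : ℝ} (hα : α < 1) {b : EReal} (hb : 0 < b)
    {ρZ : ℝ → ℝ} (hZc : Continuous ρZ)
    (hZpos : ∀ x : ℝ, 0 < x → (0 < ρZ x ↔ (x : EReal) < b))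
    (hZmom : Integrable fun y => y * ρZ y)
    (hZP : ∀ x : ℝ, 0 < x → (x : EReal) < b →
      ∫ y in Ioi x, y * ρZ y = (α * x ^ 2 + β * x + γ) * ρZ x)
    {ρ : ℝ → ℝ} (hpos : ∀ x : ℝ, 0 < x → (0 < ρ x ↔ (x : EReal) < b))
    (hint : Integrable ρ) (hmom : Integrable fun y => y * ρ y)
    (hsq : Integrable fun y => y ^ 2 * ρ y) :
    ((∀ᵐ x : ℝ, 0 < x → (x : EReal) < b →
        (α * x ^ 2 + β * x + γ) * ρ x ≤ ∫ y in Ioi x, y * ρ y) →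
      ∫ y in Ioi 0, (α * y ^ 2 + β * y + γ) * ρ y ≤ ∫ y in Ioi 0, y ^ 2 * ρ y) ∧
    ((∀ᵐ x : ℝ, 0 < x → (x : EReal) < b →
        ∫ y in Ioi x, y * ρ y ≤ (α * x ^ 2 + β * x + γ) * ρ x) →
      ∫ y in Ioi 0, y ^ 2 * ρ y ≤ ∫ y in Ioi 0, (α * y ^ 2 + β * y + γ) * ρ y) := by
  have hqint := integrable_quadratic_mul hint hmom hsq α β γ
  have hyy : Integrable fun y => y * (y * ρ y) :=
    hsq.congr (Eventually.of_forall fun y => by ring)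
  have hF := integral_Ioi_integral_Ioi hmom hyy
  have hF0 : ∫ x in Ioi (0 : ℝ), ∫ y in Ioi x, y * ρ y = ∫ y in Ioi 0, y ^ 2 * ρ y := by
    rw [(hF 0).2]
    exact integral_congr_ae (Eventually.of_forall fun y => by ring)
  rw [← hF0]
  have hge : (∀ᵐ x : ℝ, 0 < x → (α * x ^ 2 + β * x + γ) * ρ x ≤ ∫ y in Ioi x, y * ρ y) →
      ∫ y in Ioi 0, (α * y ^ 2 + β * y + γ) * ρ y ≤
        ∫ x in Ioi (0 : ℝ), ∫ y in Ioi x, y * ρ y := fun h =>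
    setIntegral_mono_on_ae hqint.integrableOn (hF 0).1 measurableSet_Ioi h
  induction b with
  | bot => simp at hb
  | top =>
    refine ⟨fun h => hge (h.mono fun x hx h0 => hx h0 (EReal.coe_lt_top x)), fun h => ?_⟩
    exact setIntegral_mono_on_ae (hF 0).1 hqint.integrableOn measurableSet_Ioi
      (h.mono fun x hx h0 => hx h0 (EReal.coe_lt_top x))
  | coe b =>
    simp only [EReal.coe_lt_coe_iff] at *
    have hb0 : 0 < b := by exact_mod_cast hb
    obtain ⟨hq, hqb⟩ := pearson_pos_and_eq_zero hb0 hZc hZpos hZmom hZP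
    refine ⟨fun h => hge (ae_mul_le_integral_Ioi hb0 hq hpos hmom h), fun h => ?_⟩
    have hsplit : ∀ {f : ℝ → ℝ}, IntegrableOn f (Ioi 0) →
        ∫ x in Ioi 0, f x = (∫ x in Ioc 0 b, f x) + ∫ x in Ioi b, f x := fun hf => by
      rw [← Ioc_union_Ioi_eq_Ioi hb0.le] at hf ⊢
      exact setIntegral_union Ioc_disjoint_Ioi_same measurableSet_Ioi
        hf.left_of_union hf.right_of_union
    rw [hsplit (hF 0).1, hsplit hqint.integrableOn, (hF b).2]
    refine add_le_add ?_ ?_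
    · refine setIntegral_mono_on_ae ((hF 0).1.mono_set Ioc_subset_Ioi_self)
        hqint.integrableOn measurableSet_Ioc ?_
      filter_upwards [h, Measure.ae_ne volume b] with x hx hxb hx'
      exact hx hx'.1 (lt_of_le_of_ne hx'.2 hxb)
    · refine setIntegral_mono_on ?_ hqint.integrableOn measurableSet_Ioi fun y hy => ?_
      · simp only [sub_mul]
        exact (hyy.sub (hmom.const_mul b)).integrableOn
      · have hρ : ρ y ≤ 0 := not_lt.1 fun h => (show b < y from hy).not_gt
          ((hpos y (hb0.trans hy)).1 h)
        have := mul_le_mul_of_nonpos_right (pearson_le_mul_sub hα hb0 hq hqb hy) hρ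
        linarith

theorem integral_Ioi_mul_comp_neg {ρ : ℝ → ℝ} (hmom : Integrable fun y => y * ρ y)
    (hcent : ∫ y, y * ρ y = 0) (x : ℝ) :
    ∫ y in Ioi x, y * ρ (-y) = ∫ y in Ioi (-x), y * ρ y := by
  have h1 : ∫ y in Ioi x, y * ρ (-y) = -∫ y in Iic (-x), y * ρ y := by
    rw [← integral_comp_neg_Ioi x fun y => y * ρ y, ← integral_neg]
    exact integral_congr_ae (Eventually.of_forall fun y => by ring)
  have h2 := intervalIntegral.integral_Iic_add_Ioi (b := -x) hmom.integrableOn hmom.integrableOn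
  linarith

theorem integrable_mul_comp_neg {ρ : ℝ → ℝ} (hmom : Integrable fun y => y * ρ y) :
    Integrable fun y => y * ρ (-y) :=
  hmom.comp_neg.neg.congr (Eventually.of_forall fun y => by simp)

/-- Comparison of the second moment of a centered density `ρ` with its integral against the Stein
factor of a centered Pearson density `ρZ` with the same support. -/
theorem integral_sq_mul_comparison {α β γ : ℝ} (hα : α < 1) {a b : EReal} (ha : a < 0)
    (hb : 0 < b) {ρZ : ℝ → ℝ} (hZc : Continuous ρZ)
    (hZpos : ∀ x : ℝ, 0 < ρZ x ↔ (a < (x : EReal) ∧ (x : EReal) < b))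
    (hZmom : Integrable fun y => y * ρZ y) (hZcent : ∫ y, y * ρZ y = 0)
    (hZP : ∀ x : ℝ, a < (x : EReal) → (x : EReal) < b →
      ∫ y in Ioi x, y * ρZ y = (α * x ^ 2 + β * x + γ) * ρZ x)
    {ρ : ℝ → ℝ} (hpos : ∀ x : ℝ, 0 < ρ x ↔ (a < (x : EReal) ∧ (x : EReal) < b))
    (hint : Integrable ρ) (hone : ∫ y, ρ y = 1) (hmom : Integrable fun y => y * ρ y)
    (hcent : ∫ y, y * ρ y = 0) (hsq : Integrable fun y => y ^ 2 * ρ y) :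
    ((∀ᵐ x : ℝ, a < (x : EReal) ∧ (x : EReal) < b →
        (α * x ^ 2 + β * x + γ) * ρ x ≤ ∫ y in Ioi x, y * ρ y) →
      γ / (1 - α) ≤ ∫ y, y ^ 2 * ρ y) ∧
    ((∀ᵐ x : ℝ, a < (x : EReal) ∧ (x : EReal) < b →
        ∫ y in Ioi x, y * ρ y ≤ (α * x ^ 2 + β * x + γ) * ρ x) →
      ∫ y, y ^ 2 * ρ y ≤ γ / (1 - α)) := by
  have hqint := integrable_quadratic_mul hint hmom hsq α β γ
  have hq : ∫ y, (α * y ^ 2 + β * y + γ) * ρ y = α * (∫ y, y ^ 2 * ρ y) + γ := by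
    have hexp : (fun y => (α * y ^ 2 + β * y + γ) * ρ y) =
        fun y => (α * (y ^ 2 * ρ y) + β * (y * ρ y)) + γ * ρ y := by
      funext y; ring
    rw [hexp, integral_add (by exact (hsq.const_mul α).add (hmom.const_mul β)) (hint.const_mul γ),
      integral_add (hsq.const_mul α) (hmom.const_mul β), integral_const_mul, integral_const_mul,
      integral_const_mul, hone, hcent]
    ring
  have hsplit : ∀ {f : ℝ → ℝ}, Integrable f →
      ∫ y, f y = (∫ y in Ioi 0, f y) + ∫ y in Ioi 0, f (-y) := fun {f} hf => by
    rw [integral_comp_neg_Ioi, neg_zero, add_comm]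
    exact (intervalIntegral.integral_Iic_add_Ioi hf.integrableOn hf.integrableOn).symm
  have haneg : ∀ x : ℝ, (x : EReal) < -a ↔ a < ((-x : ℝ) : EReal) := fun x => by
    rw [EReal.coe_neg, EReal.lt_neg_comm]
  have hax : ∀ x : ℝ, 0 < x → a < (x : EReal) := fun x hx => ha.trans (by exact_mod_cast hx)
  have hbx : ∀ x : ℝ, 0 < x → ((-x : ℝ) : EReal) < b := fun x hx =>
    lt_trans (by exact_mod_cast neg_lt_zero.2 hx) hb
  have hsq' : Integrable fun y => y ^ 2 * ρ (-y) :=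
    hsq.comp_neg.congr (Eventually.of_forall fun y => by simp)
  have hR := integral_Ioi_sq_mul_comparison hα hb hZc
    (fun x hx => by simp [hZpos, hax x hx]) hZmom (fun x hx hxb => hZP x (hax x hx) hxb)
    (fun x hx => by simp [hpos, hax x hx]) hint hmom hsq
  have hL := integral_Ioi_sq_mul_comparison (α := α) (β := -β) (γ := γ) hα (b := -a)
    (by simpa using EReal.neg_lt_neg_iff.2 ha) (hZc.comp continuous_neg)
    (fun x hx => by simp only [Function.comp_apply]; rw [hZpos, haneg, and_iff_left (hbx x hx)])
    (integrable_mul_comp_neg hZmom)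
    (fun x hx hxb => by
      simp only [Function.comp_apply]
      rw [integral_Ioi_mul_comp_neg hZmom hZcent,
        hZP (-x) ((haneg x).1 hxb) (hbx x hx)]
      ring)
    (ρ := fun y => ρ (-y))
    (fun x hx => by rw [hpos, haneg, and_iff_left (hbx x hx)])
    hint.comp_neg (integrable_mul_comp_neg hmom) hsq'
  have hV := hsplit hsq
  have hQ := hsplit hqint
  have hqneg : ∀ y : ℝ, α * (-y) ^ 2 + β * -y + γ = α * y ^ 2 + -β * y + γ := fun y => by ring
  simp only [neg_sq] at hV
  simp only [hqneg] at hQ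
  simp only [integral_Ioi_mul_comp_neg hmom hcent] at hL
  have hreflect : ∀ {p : ℝ → Prop}, (∀ᵐ x, p x) → ∀ᵐ x : ℝ, p (-x) := fun h =>
    (Measure.measurePreserving_neg (volume : Measure ℝ)).quasiMeasurePreserving.ae h
  have h1α : 0 < 1 - α := sub_pos.2 hα
  constructor
  · intro h
    have h1 := hR.1 (h.mono fun x hx h0 hxb => hx ⟨hax x h0, hxb⟩)
    have h2 := hL.1 ((hreflect h).mono fun x hx h0 hxb => by
      simpa only [hqneg] using hx ⟨(haneg x).1 hxb, hbx x h0⟩)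
    rw [div_le_iff₀ h1α]
    linarith
  · intro h
    have h1 := hR.2 (h.mono fun x hx h0 hxb => hx ⟨hax x h0, hxb⟩)
    have h2 := hL.2 ((hreflect h).mono fun x hx h0 hxb => by
      simpa only [hqneg] using hx ⟨(haneg x).1 hxb, hbx x h0⟩)
    rw [le_div_iff₀ h1α]
    linarith

/-- Proposition 4.3 of Eden–Viens, variance comparison.
`Z` is a centered Pearson random variable with density `ρZ` positive exactly on
`(a,b)` and Stein factor `gZ(z) = α z² + β z + γ` there; Assumption P1 holds
(`E[Z²] < ∞`, `z³ρZ(z) → 0` at the endpoints; in particular `α < 1`).  `X` is a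
centered square-integrable random variable whose density `ρX` is positive exactly on
`(a,b)` (the supports coincide), with Stein factor `gX`.
1. If `gX(x) ≥ α x² + β x + γ` for a.e. `x ∈ (a,b)` then `Var[X] ≥ γ/(1-α) = Var[Z]`;
2. if instead `gX(x) ≤ α x² + β x + γ` a.e. then `Var[X] ≤ γ/(1-α) = Var[Z]`. -/
theorem stmt_11
    (a b : EReal) (ha : a < 0) (hb : 0 < b) (α β γ : ℝ) (hα : α < 1)
    (ρZ : ℝ → ℝ)
    (hρZ_cont : Continuous ρZ)
    (hρZ_pos : ∀ x : ℝ, 0 < ρZ x ↔ (a < (x : EReal) ∧ (x : EReal) < b))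
    (hρZ_diff : ∀ x : ℝ, a < (x : EReal) → (x : EReal) < b → DifferentiableAt ℝ ρZ x)
    (hρZ_int : Integrable ρZ)
    (hρZ_one : ∫ y, ρZ y = 1)
    (hZmom : Integrable fun y => y * ρZ y)
    (hZcent : ∫ y, y * ρZ y = 0)
    (hPearson : ∀ z : ℝ, a < (z : EReal) → (z : EReal) < b →
      (∫ y in Set.Ioi z, y * ρZ y) / ρZ z = α * z ^ 2 + β * z + γ)
    (hZsq : Integrable fun y => y ^ 2 * ρZ y)
    (hP1a : Filter.Tendsto (fun z : ℝ => z ^ 3 * ρZ z)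
      (Filter.comap (fun x : ℝ => (x : EReal)) (nhdsWithin a (Set.Ioi a))) (nhds 0))
    (hP1b : Filter.Tendsto (fun z : ℝ => z ^ 3 * ρZ z)
      (Filter.comap (fun x : ℝ => (x : EReal)) (nhdsWithin b (Set.Iio b))) (nhds 0))
    -- the random variable `X`, with the same support as `Z`:
    (ρX : ℝ → ℝ)
    (hρX_meas : Measurable ρX)
    (hρX_pos : ∀ x : ℝ, 0 < ρX x ↔ (a < (x : EReal) ∧ (x : EReal) < b))
    (hρX_int : Integrable ρX)
    (hρX_one : ∫ y, ρX y = 1)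
    (hXmom : Integrable fun y => y * ρX y)
    (hXcent : ∫ y, y * ρX y = 0)
    (hXsq : Integrable fun y => y ^ 2 * ρX y)
    (gX : ℝ → ℝ)
    (hgX : ∀ x : ℝ, a < (x : EReal) → (x : EReal) < b →
      gX x = (∫ y in Set.Ioi x, y * ρX y) / ρX x) :
    ((∀ᵐ x : ℝ ∂volume, (a < (x : EReal) ∧ (x : EReal) < b) →
        α * x ^ 2 + β * x + γ ≤ gX x) →
      γ / (1 - α) ≤ (∫ y, y ^ 2 * ρX y) ∧ γ / (1 - α) = ∫ y, y ^ 2 * ρZ y) ∧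
    ((∀ᵐ x : ℝ ∂volume, (a < (x : EReal) ∧ (x : EReal) < b) →
        gX x ≤ α * x ^ 2 + β * x + γ) →
      (∫ y, y ^ 2 * ρX y) ≤ γ / (1 - α) ∧ γ / (1 - α) = ∫ y, y ^ 2 * ρZ y) := by
  have hP : ∀ x : ℝ, a < (x : EReal) → (x : EReal) < b →
      ∫ y in Ioi x, y * ρZ y = (α * x ^ 2 + β * x + γ) * ρZ x := fun x hax hxb =>
    (div_eq_iff ((hρZ_pos x).2 ⟨hax, hxb⟩).ne').1 (hPearson x hax hxb)
  have hZ := integral_sq_mul_comparison hα ha hb hρZ_cont hρZ_pos hZmom hZcent hP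
    hρZ_pos hρZ_int hρZ_one hZmom hZcent hZsq
  have hX := integral_sq_mul_comparison hα ha hb hρZ_cont hρZ_pos hZmom hZcent hP
    hρX_pos hρX_int hρX_one hXmom hXcent hXsq
  have hVar : γ / (1 - α) = ∫ y, y ^ 2 * ρZ y :=
    le_antisymm (hZ.1 (Eventually.of_forall fun x hx => (hP x hx.1 hx.2).ge))
      (hZ.2 (Eventually.of_forall fun x hx => (hP x hx.1 hx.2).le))
  refine ⟨fun h => ⟨hX.1 (h.mono fun x hx hab => ?_), hVar⟩,
    fun h => ⟨hX.2 (h.mono fun x hx hab => ?_), hVar⟩⟩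
  · have := hx hab
    rwa [hgX x hab.1 hab.2, le_div_iff₀ ((hρX_pos x).2 hab)] at this
  · have := hx hab
    rwa [hgX x hab.1 hab.2, div_le_iff₀ ((hρX_pos x).2 hab)] at this
end

section
/- Assume g(x) ≥ α x² + β x + γ for almost every x ∈ (a,+∞), and assume there exists a constant c > 2 such that P[X > z] ≤ zρ(z)/c for all large enough z. Then for all large enough z: P[X > z] ≥ ((c−2)Q(z))/((c−2)Q(z) + 2z²) · Φ_*(z), where Q(z) = (1−α)z² + γ. Moreover, the existence of such a c > 2 is guaranteed whenever g(z) ≤ z²/c for all large enough z. -/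
open MeasureTheory Filter Set

/-- The integral of `f` over the half-line `(x, ∞)`. -/
noncomputable def tailIntegral (f : ℝ → ℝ) (x : ℝ) : ℝ := ∫ y in Ioi x, f y

section TailIntegral

variable {f : ℝ → ℝ}

lemma tailIntegral_eq_sub (hf : Integrable f) (c : ℝ) :
    tailIntegral f = fun x => tailIntegral f c - ∫ y in c..x, f y := by
  ext x
  have := intervalIntegral.integral_Ioi_sub_Ioi' (hf.integrableOn (s := Ioi c))
    (hf.integrableOn (s := Ioi x))
  unfold tailIntegral
  linarith

lemma tailIntegral_eq_integral_sub (hf : Integrable f) (x : ℝ) :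
    tailIntegral f x = (∫ y, f y) - ∫ y in Iic x, f y := by
  have := intervalIntegral.integral_Iic_add_Ioi (hf.integrableOn (s := Iic x))
    (hf.integrableOn (s := Ioi x))
  unfold tailIntegral
  linarith

lemma continuous_tailIntegral (hf : Integrable f) : Continuous (tailIntegral f) := by
  rw [tailIntegral_eq_sub hf 0]
  exact continuous_const.sub (hf.continuous_primitive 0)

lemma tendsto_tailIntegral_atTop (f : ℝ → ℝ) : Tendsto (tailIntegral f) atTop (nhds 0) :=
  tendsto_integral_Ioi_zero tendsto_id

lemma absolutelyContinuousOnInterval_tailIntegral (hf : Integrable f) (x y : ℝ) :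
    AbsolutelyContinuousOnInterval (tailIntegral f) x y := by
  rw [tailIntegral_eq_sub hf x]
  exact AbsolutelyContinuousOnInterval.fun_sub
    (contDiff_const.contDiffOn.absolutelyContinuousOnInterval)
    (hf.intervalIntegrable.absolutelyContinuousOnInterval_intervalIntegral left_mem_uIcc)

lemma ae_hasDerivAt_tailIntegral (hf : Integrable f) :
    ∀ᵐ x, HasDerivAt (tailIntegral f) (-f x) x := by
  filter_upwards [LocallyIntegrable.ae_hasDerivAt_integral hf.locallyIntegrable] with x hx
  rw [tailIntegral_eq_sub hf 0]
  exact (hx 0).const_sub _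

lemma hasDerivAt_tailIntegral (hf : Integrable f) (hc : Continuous f) (x : ℝ) :
    HasDerivAt (tailIntegral f) (-f x) x := by
  rw [tailIntegral_eq_sub hf 0]
  exact (hc.integral_hasStrictDerivAt 0 x).hasDerivAt.const_sub _

lemma contDiff_tailIntegral (hf : Integrable f) (hc : Continuous f) :
    ContDiff ℝ 1 (tailIntegral f) := by
  rw [contDiff_one_iff_deriv]
  refine ⟨fun x => (hasDerivAt_tailIntegral hf hc x).differentiableAt, ?_⟩
  rw [show deriv (tailIntegral f) = fun x => -f x from
    funext fun x => (hasDerivAt_tailIntegral hf hc x).deriv]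
  exact hc.neg

end TailIntegral

/-- An absolutely continuous function whose derivative is a.e. nonnegative is monotone. -/
lemma AbsolutelyContinuousOnInterval.le_of_ae_hasDerivAt_nonneg {F F' : ℝ → ℝ} {x y : ℝ}
    (hxy : x ≤ y) (hF : AbsolutelyContinuousOnInterval F x y)
    (hd : ∀ᵐ t, t ∈ Icc x y → HasDerivAt F (F' t) t ∧ 0 ≤ F' t) : F x ≤ F y := by
  rw [← sub_nonneg, ← hF.integral_deriv_eq_sub, intervalIntegral.integral_of_le hxy]
  refine setIntegral_nonneg_of_ae_restrict ?_
  rw [EventuallyLE, ae_restrict_iff' measurableSet_Ioc]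
  filter_upwards [hd] with t ht hm
  obtain ⟨h1, h2⟩ := ht (Ioc_subset_Icc_self hm)
  simpa [h1.deriv] using h2

/-- `ρ` is the density of a centered integrable real random variable. -/
structure IsCenteredDensity (ρ : ℝ → ℝ) : Prop where
  nonneg : 0 ≤ᵐ[volume] ρ
  integrable : Integrable ρ
  integral_eq_one : ∫ y, ρ y = 1
  integrable_mul : Integrable fun y => y * ρ y
  integral_mul_eq_zero : ∫ y, y * ρ y = 0

section Moments

variable {ρ : ℝ → ℝ}

lemma IsCenteredDensity.mul_tailIntegral_le (h : IsCenteredDensity ρ) (x : ℝ) :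
    x * tailIntegral ρ x ≤ tailIntegral (fun y => y * ρ y) x := by
  unfold tailIntegral
  rw [← integral_const_mul]
  refine setIntegral_mono_on_ae (h.integrable.const_mul x).integrableOn h.integrable_mul.integrableOn measurableSet_Ioi ?_
  filter_upwards [h.nonneg] with y hy hxy
  exact mul_le_mul_of_nonneg_right (le_of_lt hxy) hy

lemma IsCenteredDensity.mul_tailIntegral_mul_le (h : IsCenteredDensity ρ)
    (h2 : Integrable fun y => y ^ 2 * ρ y) {x : ℝ}
    (hx : 0 ≤ x) :
    x * tailIntegral (fun y => y * ρ y) x ≤ tailIntegral (fun y => y ^ 2 * ρ y) x := by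
  unfold tailIntegral
  rw [← integral_const_mul]
  refine setIntegral_mono_on_ae (h.integrable_mul.const_mul x).integrableOn h2.integrableOn measurableSet_Ioi ?_
  filter_upwards [h.nonneg] with y hy hxy
  have hxy' : x < y := hxy
  have : 0 ≤ ρ y := hy
  have : 0 ≤ (y - x) * y * ρ y := by
    have := hx.trans hxy'.le
    have := sub_nonneg.2 hxy'.le
    positivity
  nlinarith

lemma IsCenteredDensity.tailIntegral_nonneg (h : IsCenteredDensity ρ) (x : ℝ) : 0 ≤ tailIntegral ρ x :=
  integral_nonneg_of_ae (ae_restrict_of_ae h.nonneg)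

lemma IsCenteredDensity.tailIntegral_le_one (h : IsCenteredDensity ρ)
    (x : ℝ) : tailIntegral ρ x ≤ 1 := by
  rw [← h.integral_eq_one]
  exact setIntegral_le_integral h.integrable h.nonneg

/-- For a centered density, `∫_x^∞ y ρ(y) dy + x P[X ≤ x] ≥ 0`. -/
lemma IsCenteredDensity.tailIntegral_mul_add_nonneg (h : IsCenteredDensity ρ) (x : ℝ) :
    0 ≤ tailIntegral (fun y => y * ρ y) x + x * (1 - tailIntegral ρ x) := by
  rw [tailIntegral_eq_integral_sub h.integrable, tailIntegral_eq_integral_sub h.integrable_mul, h.integral_eq_one, h.integral_mul_eq_zero]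
  have : ∫ y in Iic x, y * ρ y ≤ ∫ y in Iic x, x * ρ y := by
    refine setIntegral_mono_on_ae h.integrable_mul.integrableOn (h.integrable.const_mul x).integrableOn
      measurableSet_Iic ?_
    filter_upwards [h.nonneg] with y hy hxy
    exact mul_le_mul_of_nonneg_right hxy hy
  rw [integral_const_mul] at this
  linarith

lemma IsCenteredDensity.tailIntegral_mul_nonneg (h : IsCenteredDensity ρ) (x : ℝ) :
    0 ≤ tailIntegral (fun y => y * ρ y) x := by
  rcases le_total 0 x with hx | hx
  · exact (mul_nonneg hx (h.tailIntegral_nonneg x)).trans (h.mul_tailIntegral_le x)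
  · have := h.tailIntegral_mul_add_nonneg x
    have := mul_nonneg (neg_nonneg.2 hx) (sub_nonneg.2 (h.tailIntegral_le_one x))
    linarith

/-- A function that is nonpositive on `(-∞, r]`, with `r < 0`, total first moment zero and
nonnegative first moment over `(r, ∞)`, vanishes a.e. on `(-∞, r]`. -/
lemma ae_eq_zero_of_tailIntegral_mul_nonneg {r : ℝ} (hr : r < 0)
    (hneg : ∀ x ≤ r, ρ x ≤ 0) (h1 : Integrable fun y => y * ρ y) (hcent : ∫ y, y * ρ y = 0)
    (htail : 0 ≤ tailIntegral (fun y => y * ρ y) r) :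
    ∀ᵐ x, x ≤ r → ρ x = 0 := by
  have hnn : ∀ x ∈ Iic r, 0 ≤ x * ρ x := fun x hx =>
    mul_nonneg_of_nonpos_of_nonpos (le_trans hx hr.le) (hneg x hx)
  rw [tailIntegral_eq_integral_sub h1, hcent] at htail
  have hz : ∫ y in Iic r, y * ρ y = 0 :=
    le_antisymm (by linarith) (setIntegral_nonneg measurableSet_Iic hnn)
  rw [setIntegral_eq_zero_iff_of_nonneg_ae
    ((ae_restrict_iff' measurableSet_Iic).2 (ae_of_all _ hnn)) h1.integrableOn] at hz
  have hz' := (ae_restrict_iff' measurableSet_Iic).1 hz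
  filter_upwards [hz'] with x hx hxr
  exact (mul_eq_zero.1 (hx hxr)).resolve_left (lt_of_le_of_lt hxr hr).ne

/-- In the situation where `ρ` is positive exactly on `(a, ∞)`, nonnegativity of the partial first
moments on `(a, ∞)` forces `ρ` to vanish a.e. off `(a, ∞)`. -/
lemma ae_eq_zero_off_support {a : EReal} (ha : a < 0)
    (hpos : ∀ x : ℝ, 0 < ρ x ↔ a < (x : EReal)) (h1 : Integrable fun y => y * ρ y)
    (hcent : ∫ y, y * ρ y = 0)
    (htail : ∀ r : ℝ, a = r → 0 ≤ tailIntegral (fun y => y * ρ y) r) :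
    ∀ᵐ x : ℝ, ¬ a < (x : EReal) → ρ x = 0 := by
  induction a with
  | bot => exact ae_of_all _ fun x hx => absurd (EReal.bot_lt_coe x) hx
  | top => simp at ha
  | coe r =>
    have := ae_eq_zero_of_tailIntegral_mul_nonneg (ρ := ρ) (r := r) (by exact_mod_cast ha)
      (fun x hx => not_lt.1 fun h => absurd ((hpos x).1 h) (by simpa using hx)) h1 hcent
      (htail r rfl)
    filter_upwards [this] with x hx hxr
    exact hx (by simpa using hxr)

lemma ae_nonneg_of_ae_eq_zero_off_support {a : EReal}
    (hpos : ∀ x : ℝ, 0 < ρ x ↔ a < (x : EReal))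
    (hoff : ∀ᵐ x : ℝ, ¬ a < (x : EReal) → ρ x = 0) : 0 ≤ᵐ[volume] ρ := by
  filter_upwards [hoff] with x hx
  by_cases h : a < (x : EReal)
  · exact ((hpos x).2 h).le
  · exact (hx h).ge

/-- The lower tail probability is arbitrarily small near the left endpoint of the support. -/
lemma exists_one_sub_tailIntegral_lt {a : EReal} (h0 : Integrable ρ) (hone : ∫ y, ρ y = 1)
    (hoff : ∀ᵐ x : ℝ, ¬ a < (x : EReal) → ρ x = 0) {z ε : ℝ} (hz : a < (z : EReal))
    (hε : 0 < ε) : ∃ x : ℝ, a < (x : EReal) ∧ x ≤ z ∧ 1 - tailIntegral ρ x < ε := by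
  induction a with
  | top => simp at hz
  | bot =>
    have ht : Tendsto (fun x : ℝ => 1 - tailIntegral ρ x) atBot (nhds 0) := by
      simp_rw [tailIntegral_eq_integral_sub h0, hone, sub_sub_cancel]
      exact tendsto_integral_Iic_zero tendsto_id
    obtain ⟨x, hx1, hx2⟩ := ((ht.eventually_lt_const hε).and (eventually_le_atBot z)).exists
    exact ⟨x, EReal.bot_lt_coe x, hx2, hx1⟩
  | coe r =>
    have hr : 1 - tailIntegral ρ r = 0 := by
      rw [tailIntegral_eq_integral_sub h0, hone, sub_sub_cancel]
      rw [setIntegral_congr_ae (g := fun _ => 0) measurableSet_Iic]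
      · simp
      · filter_upwards [hoff] with x hx hxr
        exact hx (by simpa using hxr)
    have hcont : Tendsto (fun x => 1 - tailIntegral ρ x) (nhdsWithin r (Ioi r)) (nhds 0) := by
      rw [← hr]
      exact (continuous_const.sub (continuous_tailIntegral h0)).continuousWithinAt
    have hrz : r < z := by exact_mod_cast hz
    obtain ⟨x, hx1, hx2⟩ := ((hcont.eventually_lt_const hε).and (Ioc_mem_nhdsGT hrz)).exists
    exact ⟨x, by exact_mod_cast hx2.1, hx2.2, hx1⟩

lemma IsCenteredDensity.tailIntegral_mul_pos {a : EReal} (h : IsCenteredDensity ρ)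
    (hρc : Continuous ρ) (hpos : ∀ x : ℝ, 0 < ρ x ↔ a < (x : EReal))
    {x : ℝ} (hx : a < (x : EReal)) : 0 < tailIntegral (fun y => y * ρ y) x := by
  have hder := hasDerivAt_tailIntegral h.integrable_mul (continuous_id.mul hρc)
  have hnn := h.tailIntegral_mul_nonneg
  rcases le_or_gt 0 x with hx0 | hx0
  · have : StrictAntiOn (tailIntegral fun y => y * ρ y) (Icc x (x + 1)) := by
      refine strictAntiOn_of_deriv_neg (convex_Icc _ _)
        (continuous_tailIntegral h.integrable_mul).continuousOn fun t ht => ?_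
      rw [interior_Icc] at ht
      rw [(hder t).deriv, neg_lt_zero]
      exact mul_pos (hx0.trans_lt ht.1)
        ((hpos t).2 (hx.trans (by exact_mod_cast ht.1)))
    exact (hnn (x + 1)).trans_lt (this (by simp) (by simp) (by simp))
  · obtain ⟨w, hw1, hw2⟩ := EReal.lt_iff_exists_real_btwn.1 hx
    have hwx : w < x := by exact_mod_cast hw2
    have : StrictMonoOn (tailIntegral fun y => y * ρ y) (Icc w x) := by
      refine strictMonoOn_of_deriv_pos (convex_Icc _ _)
        (continuous_tailIntegral h.integrable_mul).continuousOn fun t ht => ?_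
      rw [interior_Icc] at ht
      rw [(hder t).deriv, neg_pos]
      exact mul_neg_of_neg_of_pos (ht.2.trans hx0)
        ((hpos t).2 (hw1.trans (by exact_mod_cast ht.1)))
    exact (hnn w).trans_lt (this (by simp [hwx.le]) (by simp [hwx.le]) hwx)

end Moments

/-- If the tail first moment factors as `g * ρ` on `(r, ∞)` with `g`, `ρ` continuous and
`ρ r ≤ 0`, it is nonnegative at `r`. -/
lemma tailIntegral_mul_nonneg_at_endpoint {ρ g : ℝ → ℝ} {r : ℝ} (hρ : Continuous ρ)
    (h1 : Integrable fun y => y * ρ y) (hr : ρ r ≤ 0) (hpos : ∀ x, r < x → 0 < ρ x)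
    (hg : Continuous g) (heq : ∀ x, r < x → tailIntegral (fun y => y * ρ y) x = g x * ρ x) :
    0 ≤ tailIntegral (fun y => y * ρ y) r := by
  have hmem : r ∈ closure (Ioi r) := by simp
  have h0 : ρ r = 0 := le_antisymm hr
    (le_on_closure (fun x hx => (hpos x hx).le) continuousOn_const hρ.continuousOn hmem)
  have hcl : EqOn (tailIntegral fun y => y * ρ y) (fun x => g x * ρ x) (closure (Ioi r)) :=
    EqOn.closure (fun x hx => heq x hx) (continuous_tailIntegral h1) (hg.mul hρ)
  simp [hcl hmem, h0]

/-- A continuous function that is a.e. nonnegative on `(r, ∞)` is nonnegative at `r`. -/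
lemma nonneg_of_ae_nonneg_Ioi {F : ℝ → ℝ} {r : ℝ} (hF : Continuous F)
    (h : ∀ᵐ x, r < x → 0 ≤ F x) : 0 ≤ F r := by
  have hd := Measure.dense_of_ae h
  have hmem : r ∈ closure (Ioi r ∩ {x | r < x → 0 ≤ F x}) := by
    refine closure_minimal (hd.open_subset_closure_inter isOpen_Ioi) isClosed_closure ?_
    simp
  exact le_on_closure (fun x hx => hx.2 hx.1) continuousOn_const hF.continuousOn hmem

section Comparison

variable {a : EReal} {ρX ρZ g : ℝ → ℝ}

lemma hasDerivAt_one_sub_tailIntegral_div (hZ : IsCenteredDensity ρZ) (hZc : Continuous ρZ)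
    {x : ℝ} (hx : 0 < tailIntegral (fun y => y * ρZ y) x) :
    HasDerivAt (fun x => (1 - tailIntegral ρZ x) / tailIntegral (fun y => y * ρZ y) x)
      (ρZ x * (tailIntegral (fun y => y * ρZ y) x + x * (1 - tailIntegral ρZ x))
        / tailIntegral (fun y => y * ρZ y) x ^ 2) x := by
  refine (((hasDerivAt_tailIntegral hZ.integrable hZc x).const_sub 1).fun_div
    (hasDerivAt_tailIntegral hZ.integrable_mul (continuous_id.mul hZc) x) hx.ne').congr_deriv ?_
  ring

lemma hasDerivAt_tailIntegral_div (hZ : IsCenteredDensity ρZ) (hZc : Continuous ρZ)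
    {x : ℝ} (hx : 0 < tailIntegral (fun y => y * ρZ y) x) :
    HasDerivAt (fun x => tailIntegral ρZ x / tailIntegral (fun y => y * ρZ y) x)
      (-(ρZ x * (tailIntegral (fun y => y * ρZ y) x - x * tailIntegral ρZ x)
        / tailIntegral (fun y => y * ρZ y) x ^ 2)) x := by
  refine ((hasDerivAt_tailIntegral hZ.integrable hZc x).fun_div
    (hasDerivAt_tailIntegral hZ.integrable_mul (continuous_id.mul hZc) x) hx.ne').congr_deriv ?_
  ring

/-- If the Stein factor of `X` dominates that `g` of `Z`, then
`P[X ≤ z] ≤ (∫_z^∞ y ρX / ∫_z^∞ y ρZ) P[Z ≤ z]`. -/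
lemma one_sub_tailIntegral_le (hX : IsCenteredDensity ρX) (hZ : IsCenteredDensity ρZ)
    (hZc : Continuous ρZ) (hZpos : ∀ x : ℝ, 0 < ρZ x ↔ a < (x : EReal))
    (hXoff : ∀ᵐ x : ℝ, ¬ a < (x : EReal) → ρX x = 0)
    (hg : ∀ z : ℝ, a < (z : EReal) → tailIntegral (fun y => y * ρZ y) z = g z * ρZ z)
    (hcmp : ∀ᵐ x : ℝ, a < (x : EReal) → g x * ρX x ≤ tailIntegral (fun y => y * ρX y) x)
    {z : ℝ} (hz : a < (z : EReal)) :
    1 - tailIntegral ρX z ≤ tailIntegral (fun y => y * ρX y) z *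
      ((1 - tailIntegral ρZ z) / tailIntegral (fun y => y * ρZ y) z) := by
  set GX := tailIntegral fun y => y * ρX y with hGX
  set GZ := tailIntegral fun y => y * ρZ y with hGZ
  have hGZpos {x : ℝ} (hx : a < (x : EReal)) : 0 < GZ x := hZ.tailIntegral_mul_pos hZc hZpos hx
  set u : ℝ → ℝ := fun x => (1 - tailIntegral ρZ x) / GZ x with hu
  have hmono {x : ℝ} (hx : a < (x : EReal)) (hxz : x ≤ z) :
      GX x * u x + tailIntegral ρX x ≤ GX z * u z + tailIntegral ρX z := by
    have hsub : ∀ t ∈ Icc x z, a < (t : EReal) := fun t ht =>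
      hx.trans_le (by exact_mod_cast ht.1)
    refine AbsolutelyContinuousOnInterval.le_of_ae_hasDerivAt_nonneg
      (F := fun t => GX t * u t + tailIntegral ρX t)
      (F' := fun t => -(t * ρX t) * u t
        + GX t * (ρZ t * (GZ t + t * (1 - tailIntegral ρZ t)) / GZ t ^ 2) + -ρX t) hxz ?_ ?_
    · refine ((absolutelyContinuousOnInterval_tailIntegral hX.integrable_mul x z).fun_mul
        (ContDiffOn.absolutelyContinuousOnInterval ?_)).fun_add
        (absolutelyContinuousOnInterval_tailIntegral hX.integrable x z)
      refine ContDiffOn.div ?_ ?_ ?_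
      · exact (contDiff_const.sub (contDiff_tailIntegral hZ.integrable hZc)).contDiffOn
      · exact (contDiff_tailIntegral hZ.integrable_mul (continuous_id.mul hZc)).contDiffOn
      · intro t ht
        rw [uIcc_of_le hxz] at ht
        exact (hGZpos (hsub t ht)).ne'
    · filter_upwards [ae_hasDerivAt_tailIntegral hX.integrable,
        ae_hasDerivAt_tailIntegral hX.integrable_mul, hcmp] with t h0 h1 hc ht
      have hat := hsub t ht
      have hGt := hGZpos hat
      refine ⟨(h1.fun_mul (hasDerivAt_one_sub_tailIntegral_div hZ hZc hGt)).fun_add h0, ?_⟩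
      have hk : 0 ≤ ρZ t * (GZ t + t * (1 - tailIntegral ρZ t)) / GZ t ^ 2 := by
        have := hZ.tailIntegral_mul_add_nonneg t
        have := ((hZpos t).2 hat).le
        positivity
      have hle := mul_le_mul_of_nonneg_right (hc hat) hk
      have heq : g t * ρX t * (ρZ t * (GZ t + t * (1 - tailIntegral ρZ t)) / GZ t ^ 2)
          = ρX t + t * ρX t * u t := by
        have : g t * ρX t * (ρZ t * (GZ t + t * (1 - tailIntegral ρZ t)) / GZ t ^ 2)
          = (g t * ρZ t) * ρX t * (GZ t + t * (1 - tailIntegral ρZ t)) / GZ t ^ 2 := by ring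
        rw [this, ← hg t hat, hu]
        field_simp
      linarith
  have hnn {x : ℝ} (hx : a < (x : EReal)) : 0 ≤ GX x * u x :=
    mul_nonneg (hX.tailIntegral_mul_nonneg x)
      (div_nonneg (sub_nonneg.2 (hZ.tailIntegral_le_one x)) (hGZpos hx).le)
  refine le_of_forall_pos_lt_add fun ε hε => ?_
  obtain ⟨x, hx, hxz, hlt⟩ :=
    exists_one_sub_tailIntegral_lt hX.integrable hX.integral_eq_one hXoff hz hε
  linarith [hmono hx hxz, hnn hx]

/-- A function `F` with `F y ≤ F z` and `-e y ≤ F y` for all large `y`, where `e → 0`, satisfies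
`0 ≤ F z`. -/
lemma nonneg_of_forall_ge_le {F e : ℝ → ℝ} {z : ℝ} (he : Tendsto e atTop (nhds 0))
    (hF : ∀ y, z ≤ y → F y ≤ F z) (hFe : ∀ y, z ≤ y → -e y ≤ F y) : 0 ≤ F z := by
  have := he.neg
  rw [neg_zero] at this
  refine le_of_tendsto this ?_
  filter_upwards [eventually_ge_atTop z] with y hy
  exact (hFe y hy).trans (hF y hy)

/-- If the derivative of `P[Z > t] / ∫_t^∞ y ρZ` is at least `-1/q` on `[z, ∞)`, then
`P[X > z]` is bounded below up to the error `E[X(X - z); X > z] / q`. -/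
lemma tailIntegral_mul_div_le (hX : IsCenteredDensity ρX) (hX2 : Integrable fun y => y ^ 2 * ρX y)
    (hZ : IsCenteredDensity ρZ) (hZc : Continuous ρZ)
    {z q : ℝ} (hz : 1 ≤ z) (hq : 0 < q)
    (hGZpos : ∀ t, z ≤ t → 0 < tailIntegral (fun y => y * ρZ y) t)
    (hκ : ∀ t, z ≤ t → ρZ t * (tailIntegral (fun y => y * ρZ y) t - t * tailIntegral ρZ t)
        / tailIntegral (fun y => y * ρZ y) t ^ 2 ≤ 1 / q) :
    tailIntegral (fun y => y * ρX y) z *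
        (tailIntegral ρZ z / tailIntegral (fun y => y * ρZ y) z)
      ≤ tailIntegral ρX z + (tailIntegral (fun y => y ^ 2 * ρX y) z
        - z * tailIntegral (fun y => y * ρX y) z) / q := by
  set GX := tailIntegral fun y => y * ρX y with hGX
  set GZ := tailIntegral fun y => y * ρZ y with hGZ
  set S := tailIntegral fun y => y ^ 2 * ρX y with hS
  set v : ℝ → ℝ := fun x => tailIntegral ρZ x / GZ x with hv
  have hv1 {t : ℝ} (ht : z ≤ t) : t * v t ≤ 1 := by
    rw [hv, ← mul_div_assoc, div_le_one (hGZpos t ht)]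
    exact hZ.mul_tailIntegral_le t
  have hv0 {t : ℝ} (ht : z ≤ t) : 0 ≤ v t :=
    div_nonneg (hZ.tailIntegral_nonneg t) (hGZpos t ht).le
  have key : 0 ≤ tailIntegral ρX z + (S z - z * GX z) / q - GX z * v z := by
    refine nonneg_of_forall_ge_le (F := fun t =>
      tailIntegral ρX t + (S t - t * GX t) / q - GX t * v t) (e := GX)
      (tendsto_tailIntegral_atTop _) (fun y hzy => ?_) (fun y hzy => ?_)
    · rw [← neg_le_neg_iff]
      refine AbsolutelyContinuousOnInterval.le_of_ae_hasDerivAt_nonneg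
        (F := fun t => -(tailIntegral ρX t + (S t - t * GX t) / q - GX t * v t))
        (F' := fun t => -(-ρX t + (-(t ^ 2 * ρX t) - (1 * GX t + t * -(t * ρX t))) / q
          - (-(t * ρX t) * v t + GX t * -(ρZ t * (GZ t - t * tailIntegral ρZ t) / GZ t ^ 2))))
        hzy ?_ ?_
      · have hGac := absolutelyContinuousOnInterval_tailIntegral hX.integrable_mul z y
        refine (((absolutelyContinuousOnInterval_tailIntegral hX.integrable z y).fun_add
          ?_).fun_sub (hGac.fun_mul (ContDiffOn.absolutelyContinuousOnInterval ?_))).fun_neg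
        · simp_rw [div_eq_inv_mul]
          exact ((absolutelyContinuousOnInterval_tailIntegral hX2 z y).fun_sub
            ((contDiff_id.contDiffOn.absolutelyContinuousOnInterval).fun_mul hGac)).const_mul q⁻¹
        · refine ContDiffOn.div ?_ ?_ ?_
          · exact (contDiff_tailIntegral hZ.integrable hZc).contDiffOn
          · exact (contDiff_tailIntegral hZ.integrable_mul (continuous_id.mul hZc)).contDiffOn
          · intro t ht
            rw [uIcc_of_le hzy] at ht
            exact (hGZpos t ht.1).ne'
      · filter_upwards [ae_hasDerivAt_tailIntegral hX.integrable,
          ae_hasDerivAt_tailIntegral hX.integrable_mul, ae_hasDerivAt_tailIntegral hX2,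
          hX.nonneg] with t h0 h1 h2 hρ ht
        refine ⟨((h0.fun_add ((h2.fun_sub ((hasDerivAt_id t).fun_mul h1)).div_const q)).fun_sub
          (h1.fun_mul (hasDerivAt_tailIntegral_div hZ hZc (hGZpos t ht.1)))).fun_neg, ?_⟩
        have e1 : 0 ≤ GX t * (1 / q - ρZ t * (GZ t - t * tailIntegral ρZ t) / GZ t ^ 2) :=
          mul_nonneg (hX.tailIntegral_mul_nonneg t) (sub_nonneg.2 (hκ t ht.1))
        have e2 : 0 ≤ ρX t * (1 - t * v t) := mul_nonneg hρ (sub_nonneg.2 (hv1 ht.1))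
        have e3 : (-(t ^ 2 * ρX t) - (1 * GX t + t * -(t * ρX t))) / q = -(GX t * (1 / q)) := by
          ring
        rw [e3]
        nlinarith
    · have hy : 1 ≤ y := hz.trans hzy
      have e1 : 0 ≤ (S y - y * GX y) / q :=
        div_nonneg (sub_nonneg.2 (hX.mul_tailIntegral_mul_le hX2 (by linarith))) hq.le
      have e2 : v y ≤ 1 := by nlinarith [hv1 hzy, hv0 hzy]
      have e3 := mul_le_mul_of_nonneg_left e2 (hX.tailIntegral_mul_nonneg y)
      have e4 := hX.tailIntegral_nonneg y
      linarith
  linarith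

/-- Lower bound on the tail of a Pearson law in terms of its first partial moment. -/
lemma pearson_tailIntegral_ge (hZ : IsCenteredDensity ρZ) (hZc : Continuous ρZ)
    {α β γ z : ℝ} (hα : α < 1 / 2) (hz : 1 ≤ z)
    (hρpos : ∀ t, z ≤ t → 0 < ρZ t)
    (hQ : ∀ t, z ≤ t → 0 < (1 - α) * t ^ 2 + γ)
    (hgpos : ∀ t, z ≤ t → 0 < α * t ^ 2 + β * t + γ)
    (hg : ∀ t, z ≤ t →
      tailIntegral (fun y => y * ρZ y) t = (α * t ^ 2 + β * t + γ) * ρZ t) :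
    tailIntegral (fun y => y * ρZ y) z * (((1 - 2 * α) * z - β) / ((1 - α) * z ^ 2 + γ))
      ≤ tailIntegral ρZ z := by
  set GZ := tailIntegral fun y => y * ρZ y with hGZ
  rw [← sub_nonneg]
  have hcont : Continuous GZ := continuous_tailIntegral hZ.integrable_mul
  refine nonneg_of_forall_ge_le (F := fun t => tailIntegral ρZ t
    - GZ t * (((1 - 2 * α) * t - β) / ((1 - α) * t ^ 2 + γ))) (e := GZ)
    (tendsto_tailIntegral_atTop _) (fun y hzy => ?_) (fun y hzy => ?_)
  · refine antitoneOn_of_hasDerivWithinAt_nonpos (convex_Icc z y) (f := fun t => tailIntegral ρZ t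
      - GZ t * (((1 - 2 * α) * t - β) / ((1 - α) * t ^ 2 + γ))) (f' := fun t => -ρZ t
      - (-(t * ρZ t) * (((1 - 2 * α) * t - β) / ((1 - α) * t ^ 2 + γ))
        + GZ t * (((1 - 2 * α) * ((1 - α) * t ^ 2 + γ)
          - ((1 - 2 * α) * t - β) * ((1 - α) * (2 * t))) / ((1 - α) * t ^ 2 + γ) ^ 2)))
      ?_ (fun t ht => ?_) (fun t ht => ?_) (left_mem_Icc.2 hzy) (right_mem_Icc.2 hzy) hzy
    · refine (continuous_tailIntegral hZ.integrable).continuousOn.sub (hcont.continuousOn.mul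
        (ContinuousOn.div (by fun_prop) (by fun_prop) fun t ht => (hQ t ht.1).ne'))
    · rw [interior_Icc] at ht
      have hL : HasDerivAt (fun t : ℝ => (1 - 2 * α) * t - β) (1 - 2 * α) t := by
        simpa using ((hasDerivAt_id t).const_mul (1 - 2 * α)).sub_const β
      have hQd : HasDerivAt (fun t : ℝ => (1 - α) * t ^ 2 + γ) ((1 - α) * (2 * t)) t := by
        simpa using ((hasDerivAt_pow 2 t).const_mul (1 - α)).add_const γ
      exact ((hasDerivAt_tailIntegral hZ.integrable hZc t).fun_sub
        ((hasDerivAt_tailIntegral hZ.integrable_mul (continuous_id.mul hZc) t).fun_mul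
          (hL.fun_div hQd (hQ t ht.1.le).ne'))).hasDerivWithinAt
    · rw [interior_Icc] at ht
      have hq := hQ t ht.1.le
      have hgt := hgpos t ht.1.le
      have hr := hρpos t ht.1.le
      have heq : -ρZ t - (-(t * ρZ t) * (((1 - 2 * α) * t - β) / ((1 - α) * t ^ 2 + γ))
        + GZ t * (((1 - 2 * α) * ((1 - α) * t ^ 2 + γ)
          - ((1 - 2 * α) * t - β) * ((1 - α) * (2 * t))) / ((1 - α) * t ^ 2 + γ) ^ 2))
          = -(ρZ t * (2 * (1 - α)) * (α * t ^ 2 + β * t + γ) ^ 2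
            / ((1 - α) * t ^ 2 + γ) ^ 2) := by
        rw [hg t ht.1.le]
        obtain ⟨q, hqγ⟩ : ∃ q, q = (1 - α) * t ^ 2 + γ := ⟨_, rfl⟩
        have hq0 : q ≠ 0 := hqγ ▸ hq.ne'
        rw [← hqγ, eq_sub_of_add_eq' hqγ.symm]
        field_simp
        ring
      rw [heq, neg_nonpos]
      have : 0 < 1 - α := by linarith
      positivity
  · have hy : 1 ≤ y := hz.trans hzy
    have hq := hQ y hzy
    have e1 : ((1 - 2 * α) * y - β) / ((1 - α) * y ^ 2 + γ) ≤ 1 := by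
      rw [div_le_one hq]
      by_cases h : 0 ≤ (1 - 2 * α) * y - β
      · nlinarith [hgpos y hzy]
      · linarith
    have e2 := mul_le_mul_of_nonneg_left e1 (hZ.tailIntegral_mul_nonneg y)
    have e3 := hZ.tailIntegral_nonneg y
    linarith

/-- If `P[X > t] ≤ t ρX(t) / c` for `t ≥ z` then `(c - 2) E[X²; X > z] ≤ c z² P[X > z]`. -/
lemma tailIntegral_sq_mul_le (hX : IsCenteredDensity ρX)
    (hX2 : Integrable fun y => y ^ 2 * ρX y) {c z : ℝ} (hc : 2 < c) (hz : 0 ≤ z)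
    (htail : ∀ t, z ≤ t → tailIntegral ρX t ≤ t * ρX t / c) :
    (c - 2) * tailIntegral (fun y => y ^ 2 * ρX y) z ≤ c * (z ^ 2 * tailIntegral ρX z) := by
  set S := tailIntegral fun y => y ^ 2 * ρX y with hS
  rw [← sub_nonneg]
  have hsq : ∀ t : ℝ, HasDerivAt (fun t : ℝ => t ^ 2) (2 * t) t := fun t => by
    simpa using hasDerivAt_pow 2 t
  refine nonneg_of_forall_ge_le
    (F := fun t => c * (t ^ 2 * tailIntegral ρX t) - (c - 2) * S t) (e := fun t => (c - 2) * S t)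
    (by simpa using (tendsto_tailIntegral_atTop _).const_mul (c - 2)) (fun y hzy => ?_)
    (fun y hzy => ?_)
  · rw [← neg_le_neg_iff]
    refine AbsolutelyContinuousOnInterval.le_of_ae_hasDerivAt_nonneg
      (F := fun t => -(c * (t ^ 2 * tailIntegral ρX t) - (c - 2) * S t))
      (F' := fun t => -(c * (2 * t * tailIntegral ρX t + t ^ 2 * -ρX t)
        - (c - 2) * -(t ^ 2 * ρX t))) hzy ?_ ?_
    · exact (((((contDiff_id.pow 2).contDiffOn.absolutelyContinuousOnInterval).fun_mul
        (absolutelyContinuousOnInterval_tailIntegral hX.integrable z y)).const_mul c).fun_sub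
        ((absolutelyContinuousOnInterval_tailIntegral hX2 z y).const_mul (c - 2))).fun_neg
    · filter_upwards [ae_hasDerivAt_tailIntegral hX.integrable,
        ae_hasDerivAt_tailIntegral hX2] with t h0 h2 ht
      refine ⟨((((hsq t).fun_mul h0).const_mul c).fun_sub (h2.const_mul (c - 2))).fun_neg, ?_⟩
      have e1 := htail t ht.1
      rw [le_div_iff₀ (by linarith)] at e1
      have e2 := mul_nonneg (hz.trans ht.1) (sub_nonneg.2 e1)
      nlinarith
  · have := mul_nonneg (sq_nonneg y) (hX.tailIntegral_nonneg y)
    have : 0 ≤ c * (y ^ 2 * tailIntegral ρX y) := by positivity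
    linarith

end Comparison

/-- Corollary 4.7 of Eden–Viens, explicit Pearson lower bound.
`Z` is a centered Pearson random variable whose density `ρZ` is positive exactly on
`(a,+∞)` (`-∞ ≤ a < 0`), with Stein factor `gZ(z) = α z² + β z + γ` there, `α < 1/2`;
Assumption P1 holds; `Φ z = P[Z > z]` and `Q(z) = (1-α)z² + γ`.  `X` is a centered
square-integrable random variable with density `ρX` positive exactly on `(a,+∞)` and
Stein factor `gX`.  Assume `gX(x) ≥ α x² + β x + γ` for a.e. `x ∈ (a,+∞)` and fix
`c > 2`.  Then:
1. if `P[X > z] ≤ z ρX(z)/c` for all large `z`, then for all large `z`,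
   `P[X > z] ≥ ((c-2)Q(z))/((c-2)Q(z) + 2z²) Φ(z)`;
2. moreover the hypothesis of 1 is guaranteed whenever `gX(z) ≤ z²/c` for all
   large `z`. -/
theorem stmt_13
    (a : EReal) (ha : a < 0) (α β γ : ℝ) (hα : α < 1 / 2)
    (ρZ : ℝ → ℝ)
    (hρZ_cont : Continuous ρZ)
    (hρZ_pos : ∀ x : ℝ, 0 < ρZ x ↔ a < (x : EReal))
    (hρZ_diff : ∀ x : ℝ, a < (x : EReal) → DifferentiableAt ℝ ρZ x)
    (hρZ_int : Integrable ρZ)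
    (hρZ_one : ∫ y, ρZ y = 1)
    (hZmom : Integrable fun y => y * ρZ y)
    (hZcent : ∫ y, y * ρZ y = 0)
    (hPearson : ∀ z : ℝ, a < (z : EReal) →
      (∫ y in Set.Ioi z, y * ρZ y) / ρZ z = α * z ^ 2 + β * z + γ)
    -- Assumption P1:
    (hZsq : Integrable fun y => y ^ 2 * ρZ y)
    (hP1a : Filter.Tendsto (fun z : ℝ => z ^ 3 * ρZ z)
      (Filter.comap (fun x : ℝ => (x : EReal)) (nhdsWithin a (Set.Ioi a))) (nhds 0))
    (hP1b : Filter.Tendsto (fun z : ℝ => z ^ 3 * ρZ z) Filter.atTop (nhds 0))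
    -- the random variable `X`, supported exactly on `(a,+∞)`:
    (ρX : ℝ → ℝ)
    (hρX_meas : Measurable ρX)
    (hρX_pos : ∀ x : ℝ, 0 < ρX x ↔ a < (x : EReal))
    (hρX_int : Integrable ρX)
    (hρX_one : ∫ y, ρX y = 1)
    (hXmom : Integrable fun y => y * ρX y)
    (hXcent : ∫ y, y * ρX y = 0)
    (hXsq : Integrable fun y => y ^ 2 * ρX y)
    (gX : ℝ → ℝ)
    (hgX : ∀ x : ℝ, a < (x : EReal) →
      gX x = (∫ y in Set.Ioi x, y * ρX y) / ρX x)
    (hcmp : ∀ᵐ x : ℝ ∂volume, a < (x : EReal) →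
      α * x ^ 2 + β * x + γ ≤ gX x)
    (c : ℝ) (hc : 2 < c) :
    ((∃ z₁ : ℝ, ∀ z : ℝ, z₁ ≤ z → (∫ y in Set.Ioi z, ρX y) ≤ z * ρX z / c) →
      ∃ z₂ : ℝ, ∀ z : ℝ, z₂ ≤ z →
        ((c - 2) * ((1 - α) * z ^ 2 + γ)) / ((c - 2) * ((1 - α) * z ^ 2 + γ) + 2 * z ^ 2)
            * (∫ y in Set.Ioi z, ρZ y)
          ≤ ∫ y in Set.Ioi z, ρX y) ∧
    ((∃ z₁ : ℝ, ∀ z : ℝ, z₁ ≤ z → gX z ≤ z ^ 2 / c) →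
      ∃ z₁ : ℝ, ∀ z : ℝ, z₁ ≤ z → (∫ y in Set.Ioi z, ρX y) ≤ z * ρX z / c) := by
  have hZeq : ∀ z : ℝ, a < (z : EReal) → tailIntegral (fun y => y * ρZ y) z
      = (α * z ^ 2 + β * z + γ) * ρZ z := fun z hz =>
    (div_eq_iff ((hρZ_pos z).2 hz).ne').1 (hPearson z hz)
  have hZ : IsCenteredDensity ρZ := by
    refine ⟨ae_nonneg_of_ae_eq_zero_off_support hρZ_pos
      (ae_eq_zero_off_support ha hρZ_pos hZmom hZcent fun r hr => ?_),
      hρZ_int, hρZ_one, hZmom, hZcent⟩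
    exact tailIntegral_mul_nonneg_at_endpoint hρZ_cont hZmom
      (not_lt.1 fun h => (hr ▸ (hρZ_pos r).1 h).false)
      (fun x hx => (hρZ_pos x).2 (hr ▸ EReal.coe_lt_coe_iff.2 hx))
      (by fun_prop : Continuous fun z : ℝ => α * z ^ 2 + β * z + γ)
      (fun x hx => hZeq x (hr ▸ EReal.coe_lt_coe_iff.2 hx))
  have hGZpos : ∀ z : ℝ, a < (z : EReal) → 0 < tailIntegral (fun y => y * ρZ y) z :=
    fun z hz => hZ.tailIntegral_mul_pos hρZ_cont hρZ_pos hz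
  have hgpos : ∀ z : ℝ, a < (z : EReal) → 0 < α * z ^ 2 + β * z + γ := fun z hz =>
    (pos_iff_pos_of_mul_pos (hZeq z hz ▸ hGZpos z hz)).2 ((hρZ_pos z).2 hz)
  have hXcmp : ∀ᵐ x : ℝ, a < (x : EReal) →
      (α * x ^ 2 + β * x + γ) * ρX x ≤ tailIntegral (fun y => y * ρX y) x := by
    filter_upwards [hcmp] with x hx hax
    have := hx hax
    rwa [hgX x hax, le_div_iff₀ ((hρX_pos x).2 hax)] at this
  have hXoff : ∀ᵐ x : ℝ, ¬ a < (x : EReal) → ρX x = 0 := by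
    refine ae_eq_zero_off_support ha hρX_pos hXmom hXcent fun r hr => ?_
    refine nonneg_of_ae_nonneg_Ioi (continuous_tailIntegral hXmom) ?_
    filter_upwards [hXcmp] with x hx hrx
    have hax : a < (x : EReal) := hr ▸ EReal.coe_lt_coe_iff.2 hrx
    exact (mul_pos (hgpos x hax) ((hρX_pos x).2 hax)).le.trans (hx hax)
  have hX : IsCenteredDensity ρX :=
    ⟨ae_nonneg_of_ae_eq_zero_off_support hρX_pos hXoff, hρX_int, hρX_one, hXmom, hXcent⟩
  have hpos_mem : ∀ z : ℝ, 0 ≤ z → a < (z : EReal) := fun z hz =>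
    ha.trans_le (by exact_mod_cast hz)
  refine ⟨fun ⟨z₁, hz₁⟩ => ⟨max z₁ (1 + 2 * |γ|), fun z hz => ?_⟩,
    fun ⟨z₁, hz₁⟩ => ⟨max z₁ 1, fun z hz => ?_⟩⟩
  · have hzz₁ : z₁ ≤ z := (le_max_left _ _).trans hz
    have hzγ : 1 + 2 * |γ| ≤ z := (le_max_right _ _).trans hz
    have hz1 : 1 ≤ z := by linarith [abs_nonneg γ]
    have haz := hpos_mem z (by linarith)
    have hmem : ∀ t, z ≤ t → a < (t : EReal) := fun t ht => hpos_mem t (by linarith)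
    have hQ : ∀ t, z ≤ t → 0 < (1 - α) * t ^ 2 + γ := fun t ht => by
      have h1 : t ≤ t ^ 2 := by nlinarith
      have h2 : 0 ≤ (1 / 2 - α) * t ^ 2 := mul_nonneg (by linarith) (sq_nonneg t)
      linarith [neg_abs_le γ]
    have hq := hQ z le_rfl
    have hlow : tailIntegral ρZ z ≤ tailIntegral ρX z
        + (tailIntegral (fun y => y ^ 2 * ρX y) z - z * tailIntegral (fun y => y * ρX y) z)
          / ((1 - α) * z ^ 2 + γ) := by
      have hG := hGZpos z haz
      rcases le_total (tailIntegral (fun y => y * ρX y) z)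
        (tailIntegral (fun y => y * ρZ y) z) with h | h
      · have h1 := one_sub_tailIntegral_le hX hZ hρZ_cont hρZ_pos hXoff hZeq hXcmp haz
        have h2 : 0 ≤ (tailIntegral (fun y => y ^ 2 * ρX y) z
            - z * tailIntegral (fun y => y * ρX y) z) / ((1 - α) * z ^ 2 + γ) :=
          div_nonneg (sub_nonneg.2 (hX.mul_tailIntegral_mul_le hXsq (by linarith))) hq.le
        have h3 : tailIntegral (fun y => y * ρX y) z *
            ((1 - tailIntegral ρZ z) / tailIntegral (fun y => y * ρZ y) z)
            ≤ 1 - tailIntegral ρZ z := by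
          rw [← mul_div_assoc, div_le_iff₀ hG, mul_comm]
          exact mul_le_mul_of_nonneg_left h (sub_nonneg.2 (hZ.tailIntegral_le_one z))
        linarith
      · refine le_trans ?_ (tailIntegral_mul_div_le hX hXsq hZ hρZ_cont hz1 hq
          (fun t ht => hGZpos t (hmem t ht)) fun t ht => ?_)
        · rw [← mul_div_assoc, le_div_iff₀ hG, mul_comm]
          exact mul_le_mul_of_nonneg_right h (hZ.tailIntegral_nonneg z)
        · have hmills := pearson_tailIntegral_ge hZ hρZ_cont (β := β) hα (hz1.trans ht)
            (fun s hs => (hρZ_pos s).2 (hmem s (ht.trans hs))) (fun s hs => hQ s (ht.trans hs))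
            (fun s hs => hgpos s (hmem s (ht.trans hs)))
            (fun s hs => hZeq s (hmem s (ht.trans hs)))
          have hGt := hGZpos t (hmem t ht)
          have hQt := hQ t ht
          have ht0 : 0 < t := by linarith
          have hρt := (hρZ_pos t).2 (hmem t ht)
          have hQle : (1 - α) * z ^ 2 + γ ≤ (1 - α) * t ^ 2 + γ := by
            have : z ^ 2 ≤ t ^ 2 := by gcongr
            nlinarith
          refine le_trans ?_ (one_div_le_one_div_of_le hq hQle)
          rw [div_le_div_iff₀ (by positivity) hQt]
          rw [← mul_div_assoc, div_le_iff₀ hQt] at hmills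
          have h4 := hZeq t (hmem t ht)
          have h5 := mul_le_mul_of_nonneg_left hmills (mul_pos ht0 hρt).le
          nlinarith
    have hsq := tailIntegral_sq_mul_le hX hXsq hc (by linarith : (0 : ℝ) ≤ z)
      (fun t ht => hz₁ t (hzz₁.trans ht))
    change _ * tailIntegral ρZ z ≤ tailIntegral ρX z
    have hGp := hX.mul_tailIntegral_le z
    have hc2 : 0 < c - 2 := by linarith
    have hz2 : 0 < z ^ 2 := by positivity
    rw [div_mul_eq_mul_div, div_le_iff₀ (by positivity)]
    rw [← sub_le_iff_le_add', le_div_iff₀ hq] at hlow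
    have h6 := mul_le_mul_of_nonneg_left hlow hc2.le
    have h7 := mul_le_mul_of_nonneg_left hGp (mul_pos hc2 (by linarith : (0 : ℝ) < z)).le
    nlinarith
  · have hz1 : 1 ≤ z := (le_max_right _ _).trans hz
    have haz := hpos_mem z (by linarith)
    have h := hz₁ z ((le_max_left _ _).trans hz)
    rw [hgX z haz, div_le_iff₀ ((hρX_pos z).2 haz)] at h
    refine le_of_mul_le_mul_left ((hX.mul_tailIntegral_le z).trans (h.trans_eq ?_))
      (by linarith : (0 : ℝ) < z)
    ring
end

section
/- (1) If limsup_{z→+∞} g(z)/z² = α for some α ∈ (0, 1/2), then limsup_{z→+∞} (ln P[X > z])/(ln z) ≤ −(1 + 1/α). (2) If limsup_{z→+∞} g(z)/z = β for some β > 0, then limsup_{z→+∞} (ln P[X > z])/z ≤ −1/β. -/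
open MeasureTheory Filter Set

open scoped Topology

/-- A discrete Grönwall inequality: a function losing at least a factor `1 + (t - s)` between
`s` and `t` decays exponentially. -/
theorem mul_exp_sub_le_of_mul_one_add_sub_le {φ : ℝ → ℝ} {s₀ t : ℝ} (hst : s₀ ≤ t)
    (h : ∀ s u, s₀ ≤ s → s ≤ u → φ u * (1 + (u - s)) ≤ φ s) :
    φ t * Real.exp (t - s₀) ≤ φ s₀ := by
  have step : ∀ δ : ℝ, 0 ≤ δ → ∀ k : ℕ, φ (s₀ + k * δ) * (1 + δ) ^ k ≤ φ s₀ := by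
    intro δ hδ k
    induction k with
    | zero => simp
    | succ k ih =>
      have hk : (0 : ℝ) ≤ k * δ := by positivity
      have h1 := h (s₀ + k * δ) (s₀ + (k + 1 : ℕ) * δ) (by linarith)
        (by push_cast; linarith)
      have h2 : 1 + (s₀ + ((k + 1 : ℕ) : ℝ) * δ - (s₀ + k * δ)) = 1 + δ := by push_cast; ring
      rw [h2] at h1
      calc φ (s₀ + (k + 1 : ℕ) * δ) * (1 + δ) ^ (k + 1)
          = φ (s₀ + (k + 1 : ℕ) * δ) * (1 + δ) * (1 + δ) ^ k := by ring
        _ ≤ φ (s₀ + k * δ) * (1 + δ) ^ k := by gcongr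
        _ ≤ φ s₀ := ih
  refine le_of_tendsto ((Real.tendsto_one_add_div_pow_exp (t - s₀)).const_mul (φ t)) ?_
  filter_upwards [eventually_gt_atTop 0] with n hn
  have hn' : (n : ℝ) ≠ 0 := by positivity
  have := step ((t - s₀) / n) (div_nonneg (sub_nonneg.2 hst) n.cast_nonneg) n
  rwa [mul_div_cancel₀ _ hn', add_sub_cancel] at this

/-- If `w t * ∫_t^∞ f ≤ f t` on `[x, y]` with `f` nonnegative there, then `∫_x^∞ f` exceeds
`∫_y^∞ f` by at least the factor `1 + ∫_x^y w`. -/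
theorem setIntegral_Ioi_mul_one_add_le {f w : ℝ → ℝ} {x y : ℝ} (hxy : x ≤ y)
    (hf : Integrable f) (hf0 : ∀ t, x ≤ t → t ≤ y → 0 ≤ f t)
    (hw : IntervalIntegrable w volume x y) (hw0 : ∀ t, x ≤ t → t ≤ y → 0 ≤ w t)
    (h : ∀ t, x ≤ t → t ≤ y → (∫ u in Ioi t, f u) * w t ≤ f t) :
    (∫ u in Ioi y, f u) * (1 + ∫ t in x..y, w t) ≤ ∫ u in Ioi x, f u := by
  have split : ∀ t, x ≤ t → t ≤ y →
      ∫ u in Ioi t, f u = (∫ u in t..y, f u) + ∫ u in Ioi y, f u := fun t _ _ =>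
    (intervalIntegral.integral_interval_add_Ioi hf.integrableOn hf.integrableOn).symm
  have mono : ∀ t ∈ Icc x y, (∫ u in Ioi y, f u) * w t ≤ f t := by
    intro t ht
    refine le_trans (mul_le_mul_of_nonneg_right ?_ (hw0 t ht.1 ht.2)) (h t ht.1 ht.2)
    rw [split t ht.1 ht.2]
    have := intervalIntegral.integral_nonneg (μ := volume) ht.2
      (fun u hu => hf0 u (ht.1.trans hu.1) hu.2)
    linarith
  have key := intervalIntegral.integral_mono_on hxy (hw.const_mul (∫ u in Ioi y, f u))
    hf.intervalIntegrable mono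
  rw [intervalIntegral.integral_const_mul] at key
  rw [split x le_rfl hxy, mul_add, mul_one]
  linarith

/-- Markov-type bound for the tail of a density by its tail first moment. -/
theorem mul_setIntegral_Ioi_le {ρ : ℝ → ℝ} {z : ℝ} (hρ : Integrable ρ)
    (hm : Integrable fun y => y * ρ y) (h0 : ∀ y, z < y → 0 ≤ ρ y) :
    z * ∫ y in Ioi z, ρ y ≤ ∫ y in Ioi z, y * ρ y := by
  rw [← integral_const_mul]
  refine setIntegral_mono_on (hρ.const_mul z).integrableOn hm.integrableOn measurableSet_Ioi ?_
  intro y hy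
  exact mul_le_mul_of_nonneg_right (le_of_lt hy) (h0 y hy)

theorem setIntegral_Ioi_pos {ρ : ℝ → ℝ} {z : ℝ} (hρ : Integrable ρ)
    (h0 : ∀ y, z < y → 0 < ρ y) : 0 < ∫ y in Ioi z, ρ y := by
  rw [setIntegral_pos_iff_support_of_nonneg_ae
    ((ae_restrict_iff' measurableSet_Ioi).2 (ae_of_all _ fun y hy => (h0 y hy).le))
    hρ.integrableOn]
  have : Function.support ρ ∩ Ioi z = Ioi z :=
    inter_eq_right.2 fun y hy => (h0 y hy).ne'
  simp [this]

/-- If `W` is a primitive of `w`, with right inverse `V`, and `(∫_t^∞ y ρ) * w t ≤ t ρ t` for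
`t ≥ z₀`, then `log P[X > z] ≤ C - W z - log z`. -/
theorem exists_log_tail_le {ρ w W V : ℝ → ℝ} {z₀ : ℝ} (hz₀ : 0 < z₀) (hρ : Integrable ρ)
    (hm : Integrable fun y => y * ρ y) (h0 : ∀ y, 0 < y → 0 < ρ y)
    (hw0 : ∀ t, z₀ ≤ t → 0 ≤ w t)
    (hw : ∀ x y, z₀ ≤ x → x ≤ y → IntervalIntegrable w volume x y)
    (hW : ∀ x y, z₀ ≤ x → x ≤ y → ∫ t in x..y, w t = W y - W x)
    (hV : Monotone V) (hWV : ∀ s, W z₀ ≤ s → W (V s) = s) (hVW : ∀ x, z₀ ≤ x → V (W x) = x)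
    (h : ∀ t, z₀ ≤ t → (∫ u in Ioi t, u * ρ u) * w t ≤ t * ρ t) :
    ∃ C, ∀ z, z₀ ≤ z → Real.log (∫ y in Ioi z, ρ y) ≤ C - W z - Real.log z := by
  have hpos : ∀ z, z₀ ≤ z → 0 < ∫ y in Ioi z, ρ y := fun z hz =>
    setIntegral_Ioi_pos hρ fun y hy => h0 y (by linarith)
  have hmk : ∀ z, z₀ ≤ z → z * ∫ y in Ioi z, ρ y ≤ ∫ y in Ioi z, y * ρ y := fun z hz =>
    mul_setIntegral_Ioi_le hρ hm fun y hy => (h0 y (by linarith)).le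
  refine ⟨Real.log (∫ y in Ioi z₀, y * ρ y) + W z₀, fun z hz => ?_⟩
  have hWz : W z₀ ≤ W z := by
    rw [← sub_nonneg, ← hW z₀ z le_rfl hz]
    exact intervalIntegral.integral_nonneg hz fun t ht => hw0 t ht.1
  have key := mul_exp_sub_le_of_mul_one_add_sub_le (φ := fun s => ∫ y in Ioi (V s), y * ρ y)
    hWz (by
      intro s u hs hsu
      have hVs : z₀ ≤ V s := (hVW z₀ le_rfl).symm.le.trans (hV hs)
      have := setIntegral_Ioi_mul_one_add_le (hV hsu) hm
        (fun t ht _ => mul_nonneg (by linarith) (h0 t (by linarith)).le)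
        (hw _ _ hVs (hV hsu)) (fun t ht _ => hw0 t (hVs.trans ht))
        (fun t ht _ => h t (hVs.trans ht))
      rwa [hW _ _ hVs (hV hsu), hWV s hs, hWV u (hs.trans hsu)] at this)
  simp only [hVW z hz, hVW z₀ le_rfl] at key
  have hz0 : 0 < z := hz₀.trans_le hz
  have hlog := Real.log_le_log (mul_pos (mul_pos hz0 (hpos z hz)) (Real.exp_pos _))
    ((mul_le_mul_of_nonneg_right (hmk z hz) (Real.exp_pos (W z - W z₀)).le).trans key)
  rw [Real.log_mul (mul_pos hz0 (hpos z hz)).ne' (Real.exp_pos _).ne',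
    Real.log_mul hz0.ne' (hpos z hz).ne', Real.log_exp] at hlog
  linarith

/-- If, for every `b > β`, `u` is eventually bounded by a function tending to `c b`, and `c` is
continuous at `β`, then the limsup of `u` is at most `c β`. -/
theorem limsup_le_of_forall_gt_eventually_le {u : ℝ → ℝ} {c : ℝ → ℝ} {β : ℝ}
    (h : ∀ b, β < b → ∃ v : ℝ → ℝ, Tendsto v atTop (𝓝 (c b)) ∧ ∀ᶠ z in atTop, u z ≤ v z)
    (hc : ContinuousAt c β) :
    limsup (fun z => (u z : EReal)) atTop ≤ (c β : EReal) := by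
  have hlim : Tendsto (fun b => (c b : EReal)) (𝓝[>] β) (𝓝 (c β : EReal)) :=
    (continuous_coe_real_ereal.tendsto _).comp (hc.tendsto.mono_left nhdsWithin_le_nhds)
  refine ge_of_tendsto hlim ?_
  filter_upwards [self_mem_nhdsWithin] with b hb
  obtain ⟨v, hv, huv⟩ := h b hb
  have hvb := (continuous_coe_real_ereal.tendsto _).comp hv
  rw [← hvb.limsup_eq]
  exact limsup_le_limsup (huv.mono fun z hz => EReal.coe_le_coe_iff.2 hz)

/-- A strict upper bound of the limsup of `u` bounds `u` on a half-line `[z₀, ∞)` with `z₀ > 0`. -/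
theorem exists_pos_forall_ge_lt_of_limsup_eq {u : ℝ → ℝ} {β b : ℝ} (hb : β < b)
    (h : limsup (fun z => (u z : EReal)) atTop = (β : EReal)) :
    ∃ z₀, 0 < z₀ ∧ ∀ z, z₀ ≤ z → u z < b := by
  have hev : ∀ᶠ z in atTop, (u z : EReal) < (b : EReal) :=
    eventually_lt_of_limsup_lt (h.trans_lt (EReal.coe_lt_coe_iff.2 hb))
  obtain ⟨z₁, hz₁⟩ := eventually_atTop.1 hev
  exact ⟨max z₁ 1, by positivity, fun z hz =>
    EReal.coe_lt_coe_iff.1 (hz₁ z ((le_max_left _ _).trans hz))⟩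

/-- Proposition 4.10 of Eden–Viens, asymptotic upper bounds.
`X` is a centered square-integrable random variable with density `ρ` positive exactly
on `(a,+∞)` (`-∞ ≤ a < 0`) and Stein factor `g(x) = (∫_x^∞ y ρ(y) dy)/ρ(x)` (the
Nourdin–Peccati conditional expectation `E[⟨DX,-DL⁻¹X⟩|X=x]`).  Limsups are taken in
`EReal` to encode the finite value of the limsup faithfully.
1. If `limsup_{z→∞} g(z)/z² = α ∈ (0,1/2)`, then
   `limsup_{z→∞} ln P[X>z] / ln z ≤ -(1 + 1/α)`.
2. If `limsup_{z→∞} g(z)/z = β > 0`, then `limsup_{z→∞} ln P[X>z] / z ≤ -1/β`. -/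
theorem stmt_16
    (a : EReal) (ha : a < 0)
    (ρ : ℝ → ℝ)
    (hρ_meas : Measurable ρ)
    (hρ_pos : ∀ x : ℝ, 0 < ρ x ↔ a < (x : EReal))
    (hρ_int : Integrable ρ) (hρ_one : ∫ y, ρ y = 1)
    (hmom : Integrable fun y => y * ρ y) (hcent : ∫ y, y * ρ y = 0)
    (hsq : Integrable fun y => y ^ 2 * ρ y)
    (g : ℝ → ℝ)
    (hg : ∀ x : ℝ, a < (x : EReal) → g x = (∫ y in Set.Ioi x, y * ρ y) / ρ x) :
    (∀ α : ℝ, 0 < α → α < 1 / 2 →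
      Filter.limsup (fun z : ℝ => ((g z / z ^ 2 : ℝ) : EReal)) Filter.atTop
        = ((α : ℝ) : EReal) →
      Filter.limsup
          (fun z : ℝ => ((Real.log (∫ y in Set.Ioi z, ρ y) / Real.log z : ℝ) : EReal))
          Filter.atTop
        ≤ ((-(1 + 1 / α) : ℝ) : EReal)) ∧
    (∀ β : ℝ, 0 < β →
      Filter.limsup (fun z : ℝ => ((g z / z : ℝ) : EReal)) Filter.atTop
        = ((β : ℝ) : EReal) →
      Filter.limsup
          (fun z : ℝ => ((Real.log (∫ y in Set.Ioi z, ρ y) / z : ℝ) : EReal))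
          Filter.atTop
        ≤ ((-(1 / β) : ℝ) : EReal)) := by
  have h0 : ∀ y : ℝ, 0 < y → a < (y : EReal) := fun y hy =>
    ha.trans (by exact_mod_cast hy)
  have hpos : ∀ y : ℝ, 0 < y → 0 < ρ y := fun y hy => (hρ_pos y).2 (h0 y hy)
  have hgρ : ∀ t : ℝ, 0 < t → ∫ y in Ioi t, y * ρ y = g t * ρ t := fun t ht => by
    rw [hg t (h0 t ht), div_mul_cancel₀ _ (hpos t ht).ne']
  constructor
  · intro α hα _ hlim
    refine limsup_le_of_forall_gt_eventually_le (c := fun b => -(1 + 1 / b)) (β := α)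
      (fun b hb => ?_) (by fun_prop (disch := positivity))
    have hb0 : 0 < b := hα.trans hb
    obtain ⟨z₀, hz₀, hgb⟩ := exists_pos_forall_ge_lt_of_limsup_eq hb hlim
    obtain ⟨C, hC⟩ := exists_log_tail_le (w := fun t => b⁻¹ * t⁻¹)
      (W := fun t => b⁻¹ * Real.log t) (V := fun s => Real.exp (b * s)) hz₀ hρ_int hmom hpos
      (fun t ht => by have := hz₀.trans_le ht; positivity)
      (fun x y hx hxy => (intervalIntegral.intervalIntegrable_inv (fun t ht => by
        rw [uIcc_of_le hxy] at ht
        exact (hz₀.trans_le (hx.trans ht.1)).ne') continuousOn_id).const_mul _)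
      (fun x y hx hxy => by
        have hx0 : 0 < x := by linarith
        have hy0 : 0 < y := by linarith
        rw [intervalIntegral.integral_const_mul, integral_inv_of_pos hx0 hy0,
          Real.log_div hy0.ne' hx0.ne', mul_sub])
      (fun s t hst => Real.exp_le_exp.2 (mul_le_mul_of_nonneg_left hst hb0.le))
      (fun s _ => by simp only [Real.log_exp]; field_simp)
      (fun x hx => by
        rw [mul_inv_cancel_left₀ hb0.ne', Real.exp_log (hz₀.trans_le hx)])
      (fun t ht => by
        have ht0 : 0 < t := hz₀.trans_le ht
        have hgt := (div_lt_iff₀ (by positivity)).1 (hgb t ht)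
        rw [hgρ t ht0]
        calc g t * ρ t * (b⁻¹ * t⁻¹) ≤ b * t ^ 2 * ρ t * (b⁻¹ * t⁻¹) := by
              have := hpos t ht0
              gcongr
          _ = t * ρ t := by field_simp)
    refine ⟨fun z => C / Real.log z - (1 + 1 / b), ?_, ?_⟩
    · simpa using (Real.tendsto_log_atTop.const_div_atTop C).sub_const (1 + 1 / b)
    · filter_upwards [eventually_ge_atTop z₀, eventually_gt_atTop 1] with z hz hz1
      have hlog : 0 < Real.log z := Real.log_pos hz1
      rw [div_le_iff₀ hlog]
      refine (hC z hz).trans_eq ?_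
      field_simp
      ring
  · intro β hβ hlim
    refine limsup_le_of_forall_gt_eventually_le (c := fun b => -(1 / b)) (β := β)
      (fun b hb => ?_) (by fun_prop (disch := positivity))
    have hb0 : 0 < b := hβ.trans hb
    obtain ⟨z₀, hz₀, hgb⟩ := exists_pos_forall_ge_lt_of_limsup_eq hb hlim
    obtain ⟨C, hC⟩ := exists_log_tail_le (w := fun _ => b⁻¹)
      (W := fun t => b⁻¹ * t) (V := fun s => b * s) hz₀ hρ_int hmom hpos
      (fun t _ => by positivity)
      (fun x y _ _ => intervalIntegrable_const)
      (fun x y _ _ => by simp; ring)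
      (fun s t hst => mul_le_mul_of_nonneg_left hst hb0.le)
      (fun s _ => inv_mul_cancel_left₀ hb0.ne' s)
      (fun x _ => mul_inv_cancel_left₀ hb0.ne' x)
      (fun t ht => by
        have ht0 : 0 < t := hz₀.trans_le ht
        have hgt := (div_lt_iff₀ ht0).1 (hgb t ht)
        rw [hgρ t ht0]
        calc g t * ρ t * b⁻¹ ≤ b * t * ρ t * b⁻¹ := by
              have := hpos t ht0
              gcongr
          _ = t * ρ t := by field_simp)
    refine ⟨fun z => C / z - 1 / b, ?_, ?_⟩
    · simpa using (tendsto_id.const_div_atTop C).sub_const (1 / b)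
    · filter_upwards [eventually_ge_atTop z₀, eventually_gt_atTop 1] with z hz hz1
      have hz0 : 0 < z := by linarith
      have hlog : 0 < Real.log z := Real.log_pos hz1
      rw [div_le_iff₀ hz0]
      calc Real.log (∫ y in Ioi z, ρ y) ≤ C - b⁻¹ * z := by linarith [hC z hz]
        _ = (C / z - 1 / b) * z := by field_simp
end

section
/- (1) If lim_{z→+∞} g(z)/z² = α for some α ∈ (0,1), then lim_{z→+∞} (ln P[X > z])/(ln z) = −(1 + 1/α). (2) If lim_{z→+∞} g(z)/z^p = β for some β > 0 and some p ∈ [0,1), then lim_{z→+∞} (ln P[X > z])/z^{2−p} = −1/(β(2−p)). -/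
open MeasureTheory Filter Set

/-- Discrete Grönwall step: iterating `f t * (1 + c * (H t - H s)) ≤ f s` along a subdivision
into `n` pieces of equal `H`-increment `δ`. -/
lemma mul_pow_le_of_subdivision {f H : ℝ → ℝ} {c δ y : ℝ} (hδ : 0 ≤ δ) (hcδ : 0 ≤ 1 + c * δ)
    (n : ℕ) : ∀ x, x ≤ y → ContinuousOn H (Icc x y) →
      (∀ s t, x ≤ s → s ≤ t → t ≤ y → f t * (1 + c * (H t - H s)) ≤ f s) →
      H y - H x = n * δ → f y * (1 + c * δ) ^ n ≤ f x := by
  induction n with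
  | zero =>
    intro x hxy _ hf hH
    have := hf x y le_rfl hxy le_rfl
    simp_all
  | succ n ih =>
    intro x hxy hc hf hH
    push_cast at hH
    have hn : 0 ≤ n * δ := by positivity
    obtain ⟨m, hm, hHm⟩ := intermediate_value_Icc hxy hc
      (show H x + δ ∈ Icc (H x) (H y) from ⟨by linarith, by linarith⟩)
    have h1 := ih m hm.2 (hc.mono (Icc_subset_Icc_left hm.1))
      (fun s t hs => hf s t (hm.1.trans hs)) (by linarith)
    have h2 := hf x m le_rfl hm.1 hm.2
    rw [show H m - H x = δ by linarith] at h2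
    calc f y * (1 + c * δ) ^ (n + 1) = f y * (1 + c * δ) ^ n * (1 + c * δ) := by ring
      _ ≤ f m * (1 + c * δ) := by gcongr
      _ ≤ f x := h2

/-- Grönwall inequality in integrated form, with respect to a continuous clock `H`. -/
lemma mul_exp_le_of_forall_mul_le {f H : ℝ → ℝ} {c x y : ℝ} (hxy : x ≤ y)
    (hH : ContinuousOn H (Icc x y)) (hHxy : H x ≤ H y)
    (hf : ∀ s t, x ≤ s → s ≤ t → t ≤ y → f t * (1 + c * (H t - H s)) ≤ f s) :
    f y * Real.exp (c * (H y - H x)) ≤ f x := by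
  have hlim := (Real.tendsto_one_add_div_pow_exp (c * (H y - H x))).const_mul (f y)
  have hone : Tendsto (fun n : ℕ => 1 + c * (H y - H x) / (n : ℝ)) atTop (nhds (1 + 0)) :=
    tendsto_const_nhds.add (tendsto_const_div_atTop_nhds_zero_nat _)
  refine le_of_tendsto hlim ?_
  filter_upwards [hone.eventually (lt_mem_nhds (show (0 : ℝ) < 1 + 0 by norm_num)),
    eventually_gt_atTop 0] with n hn hn0
  have hn' : (0 : ℝ) < n := by exact_mod_cast hn0
  rw [mul_div_assoc] at hn ⊢
  exact mul_pow_le_of_subdivision (div_nonneg (sub_nonneg.2 hHxy) hn'.le) hn.le n x hxy hH hf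
    (by field_simp)

/-- If the relative decrement of a positive function `f` is eventually comparable to `γ` times
the increment of `H`, then `log f ∼ -γ H`. -/
lemma tendsto_log_div_of_decrement_bounds {f H : ℝ → ℝ} {γ : ℝ} (hγ : 0 < γ)
    (hH : ContinuousOn H (Ici 1)) (hmono : MonotoneOn H (Ici 1)) (htop : Tendsto H atTop atTop)
    (hpos : ∀ x, 1 ≤ x → 0 < f x)
    (hup : ∀ c, 0 < c → c < γ → ∃ N, 1 ≤ N ∧ ∀ s t, N ≤ s → s ≤ t →
      c * f t * (H t - H s) ≤ f s - f t)
    (hlow : ∀ c, γ < c → ∃ N, 1 ≤ N ∧ ∀ s t, N ≤ s → s ≤ t →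
      f s - f t ≤ c * f s * (H t - H s)) :
    Tendsto (fun z => Real.log (f z) / H z) atTop (nhds (-γ)) := by
  have hconst : ∀ k c : ℝ, Tendsto (fun z => k / H z - c) atTop (nhds (0 - c)) := fun k c =>
    (htop.const_div_atTop k).sub_const c
  rw [tendsto_order]
  constructor
  · intro b hb
    obtain ⟨c, hc1, hc2⟩ := exists_between (show γ < -b by linarith)
    obtain ⟨N, hN, hs⟩ := hlow c hc1
    filter_upwards [eventually_ge_atTop N, htop.eventually_gt_atTop 0,
      (hconst (Real.log (f N) + c * H N) c).eventually (lt_mem_nhds (show b < 0 - c by linarith))]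
      with z hz hz0 hb'
    have hsub : Icc N z ⊆ Ici 1 := fun w hw => hN.trans hw.1
    have hg := mul_exp_le_of_forall_mul_le (f := fun w => (f w)⁻¹) (c := -c) hz (hH.mono hsub)
      (hmono hN (hN.trans hz) hz) (fun s t hs1 hst _ => by
        have h1 := hpos s (hN.trans hs1)
        have h2 := hpos t (hN.trans (hs1.trans hst))
        have h3 := hs s t hs1 hst
        rw [inv_mul_le_iff₀ h2, ← div_eq_mul_inv, le_div_iff₀ h1]
        linarith)
    have hfz := hpos z (hN.trans hz)
    have hfN := hpos N hN
    have := Real.log_le_log (by positivity) hg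
    rw [Real.log_mul (by positivity) (by positivity), Real.log_exp, Real.log_inv,
      Real.log_inv] at this
    refine hb'.trans_le ?_
    rw [div_sub' hz0.ne']
    gcongr
    linarith
  · intro b hb
    obtain ⟨c, hc1, hc2⟩ := exists_between (show max 0 (-b) < γ from max_lt hγ (by linarith))
    obtain ⟨hc0, hcb⟩ := max_lt_iff.1 hc1
    obtain ⟨N, hN, hs⟩ := hup c hc0 hc2
    filter_upwards [eventually_ge_atTop N, htop.eventually_gt_atTop 0,
      (hconst (Real.log (f N) + c * H N) c).eventually (gt_mem_nhds (show 0 - c < b by linarith))]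
      with z hz hz0 hb'
    have hsub : Icc N z ⊆ Ici 1 := fun w hw => hN.trans hw.1
    have hg := mul_exp_le_of_forall_mul_le (f := f) (c := c) hz (hH.mono hsub)
      (hmono hN (hN.trans hz) hz) (fun s t hs1 hst _ => by linarith [hs s t hs1 hst])
    have hfz := hpos z (hN.trans hz)
    have := Real.log_le_log (by positivity) hg
    rw [Real.log_mul (by positivity) (by positivity), Real.log_exp] at this
    refine lt_of_le_of_lt ?_ hb'
    rw [div_sub' hz0.ne']
    gcongr
    linarith

section Tail

variable {ρ : ℝ → ℝ}

lemma setIntegral_Ioi_pos_s17 {f : ℝ → ℝ} (hf : Integrable f) {x : ℝ} (hpos : ∀ y, x < y → 0 < f y) :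
    0 < ∫ y in Ioi x, f y := by
  rw [setIntegral_pos_iff_support_of_nonneg_ae
    ((ae_restrict_iff' measurableSet_Ioi).2 (ae_of_all _ fun y hy => (hpos y hy).le))
    hf.integrableOn]
  have : Ioi x ⊆ Function.support f ∩ Ioi x := fun y hy => ⟨(hpos y hy).ne', hy⟩
  refine lt_of_lt_of_le ?_ (measure_mono this)
  simp

lemma setIntegral_Ioi_sub {f : ℝ → ℝ} (hf : Integrable f) (x y : ℝ) :
    (∫ w in Ioi x, f w) - ∫ w in Ioi y, f w = ∫ w in x..y, f w :=
  (intervalIntegral.integral_Ioi_sub_Ioi' hf.integrableOn hf.integrableOn)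

lemma tail_mul_le (hpos : ∀ x, 0 < x → 0 < ρ x) (hint : Integrable ρ)
    (hmom : Integrable fun y => y * ρ y) {z : ℝ} (hz : 0 < z) :
    z * ∫ y in Ioi z, ρ y ≤ ∫ y in Ioi z, y * ρ y := by
  rw [← integral_const_mul]
  refine setIntegral_mono_on (hint.const_mul z).integrableOn hmom.integrableOn
    measurableSet_Ioi fun y hy => ?_
  have := hpos y (hz.trans hy)
  have : z < y := hy
  gcongr

lemma sub_le_two_mul_tail (hpos : ∀ x, 0 < x → 0 < ρ x) (hint : Integrable ρ)
    (hmom : Integrable fun y => y * ρ y) {z : ℝ} (hz : 0 < z) :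
    (∫ y in Ioi z, y * ρ y) - ∫ y in Ioi (2 * z), y * ρ y ≤ 2 * z * ∫ y in Ioi z, ρ y := by
  have hle : z ≤ 2 * z := by linarith
  rw [setIntegral_Ioi_sub hmom]
  have htail : 0 < ∫ y in Ioi (2 * z), ρ y :=
    setIntegral_Ioi_pos_s17 hint fun y hy => hpos y (by linarith)
  have hsub := setIntegral_Ioi_sub hint z (2 * z)
  calc ∫ y in z..2 * z, y * ρ y ≤ ∫ y in z..2 * z, 2 * z * ρ y := by
        refine intervalIntegral.integral_mono_on hle hmom.intervalIntegrable
          (hint.const_mul _).intervalIntegrable fun y hy => ?_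
        have := hpos y (hz.trans_le hy.1)
        have := hy.2
        gcongr
    _ = 2 * z * ∫ y in z..2 * z, ρ y := by rw [intervalIntegral.integral_const_mul]
    _ ≤ _ := by gcongr; linarith

/-- Tail asymptotics with a general clock `H`, `H' = h`: if `g(z) h(z) / z → β` for the Stein
factor `g`, then the first-moment tail decays like `exp (-H / β)`, and the logarithm of the
probability tail differs from that of the first-moment tail by `-log z + O(1)`. -/
lemma tail_asymptotics {g H h : ℝ → ℝ} {β δ : ℝ} (hpos : ∀ x, 0 < x → 0 < ρ x)
    (hint : Integrable ρ) (hmom : Integrable fun y => y * ρ y)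
    (hg : ∀ x, 0 < x → g x = (∫ y in Ioi x, y * ρ y) / ρ x) (hβ : 0 < β)
    (hderiv : ∀ x, 1 ≤ x → HasDerivAt H (h x) x) (hcont : ContinuousOn h (Ici 1))
    (hh : ∀ x, 1 ≤ x → 0 < h x) (htop : Tendsto H atTop atTop) (hδ : 0 < δ)
    (hdouble : ∀ x, 1 ≤ x → δ ≤ H (2 * x) - H x)
    (hlim : Tendsto (fun z => g z * h z / z) atTop (nhds β)) :
    Tendsto (fun z => Real.log (∫ y in Ioi z, y * ρ y) / H z) atTop (nhds (-β⁻¹)) ∧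
    ∃ κ : ℝ, ∀ᶠ z in atTop,
      |Real.log (∫ y in Ioi z, ρ y) - (Real.log (∫ y in Ioi z, y * ρ y) - Real.log z)| ≤ κ := by
  set f : ℝ → ℝ := fun z => ∫ y in Ioi z, y * ρ y with hf
  have hfpos : ∀ x, 0 ≤ x → 0 < f x := fun x hx =>
    setIntegral_Ioi_pos_s17 hmom fun y hy => mul_pos (by linarith) (hpos y (by linarith))
  have hanti : ∀ x y, 0 < x → x ≤ y → f y ≤ f x := fun x y hx hxy => by
    have h1 := setIntegral_Ioi_sub hmom x y
    have h2 : 0 ≤ ∫ w in x..y, w * ρ w := by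
      refine intervalIntegral.integral_nonneg hxy fun w hw => ?_
      have : 0 < w := hx.trans_le hw.1
      exact (mul_pos this (hpos w this)).le
    simp only [hf]
    linarith
  have hHcont : ContinuousOn H (Ici 1) := fun x hx => (hderiv x hx).continuousAt.continuousWithinAt
  have hhint : ∀ s t, 1 ≤ s → s ≤ t → IntervalIntegrable h volume s t := fun s t hs hst =>
    (hcont.mono (by rw [uIcc_of_le hst]; exact fun w hw => hs.trans hw.1)).intervalIntegrable
  have hHint : ∀ s t, 1 ≤ s → s ≤ t → ∫ w in s..t, h w = H t - H s := fun s t hs hst =>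
    intervalIntegral.integral_eq_sub_of_hasDerivAt
      (fun w hw => hderiv w (by rw [uIcc_of_le hst] at hw; exact hs.trans hw.1)) (hhint s t hs hst)
  have hmono : MonotoneOn H (Ici 1) := fun s hs t _ hst => by
    have h1 := hHint s t hs hst
    have h2 : 0 ≤ ∫ w in s..t, h w :=
      intervalIntegral.integral_nonneg hst fun w hw => (hh w (hs.trans hw.1)).le
    linarith
  have hrate : ∀ x, 1 ≤ x → x * ρ x * (g x * h x / x) = f x * h x := fun x hx => by
    have hx0 : 0 < x := by linarith
    have := hpos x hx0
    rw [hg x hx0]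
    simp only [hf]
    field_simp
  have hup : ∀ c, 0 < c → c < β⁻¹ → ∃ N, 1 ≤ N ∧ ∀ s t, N ≤ s → s ≤ t →
      c * f t * (H t - H s) ≤ f s - f t := by
    intro c hc hcβ
    have hβc : β < c⁻¹ := (lt_inv_comm₀ hc hβ).1 hcβ
    obtain ⟨N, hN⟩ := eventually_atTop.1 (hlim.eventually (gt_mem_nhds hβc))
    refine ⟨max N 1, le_max_right _ _, fun s t hs hst => ?_⟩
    have hs1 : 1 ≤ s := (le_max_right _ _).trans hs
    rw [← hHint s t hs1 hst, ← intervalIntegral.integral_const_mul]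
    simp only [hf]
    rw [setIntegral_Ioi_sub hmom]
    refine intervalIntegral.integral_mono_on hst ((hhint s t hs1 hst).const_mul _)
      hmom.intervalIntegrable fun w hw => ?_
    have hw1 : 1 ≤ w := hs1.trans hw.1
    have h1 := (hN w ((le_max_left _ _).trans (hs.trans hw.1))).le
    have h2 := hanti w t (by linarith) hw.2
    have h3 := hpos w (by linarith)
    have h4 := hh w hw1
    have h5 : f w * h w ≤ w * ρ w * c⁻¹ := by
      rw [← hrate w hw1]
      gcongr
    calc c * f t * h w ≤ c * f w * h w := by gcongr
      _ = c * (f w * h w) := by ring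
      _ ≤ c * (w * ρ w * c⁻¹) := by gcongr
      _ = w * ρ w := by field_simp
  have hlow : ∀ c, β⁻¹ < c → ∃ N, 1 ≤ N ∧ ∀ s t, N ≤ s → s ≤ t →
      f s - f t ≤ c * f s * (H t - H s) := by
    intro c hcβ
    have hc : 0 < c := (inv_pos.2 hβ).trans hcβ
    have hβc : c⁻¹ < β := (inv_lt_comm₀ hβ hc).1 hcβ
    obtain ⟨N, hN⟩ := eventually_atTop.1 (hlim.eventually (lt_mem_nhds hβc))
    refine ⟨max N 1, le_max_right _ _, fun s t hs hst => ?_⟩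
    have hs1 : 1 ≤ s := (le_max_right _ _).trans hs
    rw [← hHint s t hs1 hst, ← intervalIntegral.integral_const_mul]
    simp only [hf]
    rw [setIntegral_Ioi_sub hmom]
    refine intervalIntegral.integral_mono_on hst hmom.intervalIntegrable
      ((hhint s t hs1 hst).const_mul _) fun w hw => ?_
    have hw1 : 1 ≤ w := hs1.trans hw.1
    have h1 := (hN w ((le_max_left _ _).trans (hs.trans hw.1))).le
    have h2 := hanti s w (by linarith) hw.1
    have h3 := hpos w (by linarith)
    have h4 := hh w hw1
    have h5 : w * ρ w * c⁻¹ ≤ f w * h w := by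
      rw [← hrate w hw1]
      gcongr
    calc w * ρ w = c * (w * ρ w * c⁻¹) := by field_simp
      _ ≤ c * (f w * h w) := by gcongr
      _ = c * f w * h w := by ring
      _ ≤ c * f s * h w := by gcongr
  refine ⟨tendsto_log_div_of_decrement_bounds (inv_pos.2 hβ) hHcont hmono htop
    (fun x hx => hfpos x (by linarith)) hup hlow, ?_⟩
  obtain ⟨c, hc, hcβ⟩ := exists_between (inv_pos.2 hβ)
  obtain ⟨N, hN, hdec⟩ := hup c hc hcβ
  have hcδ : 0 < c * δ := mul_pos hc hδ
  set q : ℝ := c * δ / (2 * (1 + c * δ)) with hq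
  have hqpos : 0 < q := by positivity
  refine ⟨|Real.log q|, ?_⟩
  filter_upwards [eventually_ge_atTop N] with z hz
  have hz1 : 1 ≤ z := hN.trans hz
  have hz0 : 0 < z := by linarith
  have hfz := hfpos z hz0.le
  have hT : 0 < ∫ y in Ioi z, ρ y := setIntegral_Ioi_pos_s17 hint fun y hy => hpos y (hz0.trans hy)
  have hle := tail_mul_le hpos hint hmom hz0
  have hge := sub_le_two_mul_tail hpos hint hmom hz0
  have hgap : c * f (2 * z) * δ ≤ f z - f (2 * z) := by
    refine le_trans ?_ (hdec z (2 * z) hz (by linarith))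
    have := hfpos (2 * z) (by linarith)
    have := hdouble z hz1
    gcongr
  have hqle : q * f z ≤ z * ∫ y in Ioi z, ρ y := by
    rw [hq, div_mul_eq_mul_div, div_le_iff₀ (by positivity)]
    have : c * δ * f z ≤ (f z - f (2 * z)) * (1 + c * δ) := by nlinarith
    calc c * δ * f z ≤ (f z - f (2 * z)) * (1 + c * δ) := this
      _ ≤ (2 * z * ∫ y in Ioi z, ρ y) * (1 + c * δ) := by gcongr
      _ = _ := by ring
  have hlog1 := Real.log_le_log (mul_pos hz0 hT) hle
  have hlog2 := Real.log_le_log (mul_pos hqpos hfz) hqle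
  rw [Real.log_mul hz0.ne' hT.ne'] at hlog1 hlog2
  rw [Real.log_mul hqpos.ne' hfz.ne'] at hlog2
  change _ ≤ Real.log (f z) at hlog1
  rw [abs_le]
  constructor
  · linarith [neg_abs_le (Real.log q)]
  · linarith [abs_nonneg (Real.log q)]

end Tail

/-- A function within bounded distance of `A - B` has, relative to a scale `S → ∞`, the same
limit as `A - B`. -/
lemma tendsto_div_of_abs_sub_le {T A B S : ℝ → ℝ} {κ l m : ℝ} (hS : Tendsto S atTop atTop)
    (hT : ∀ᶠ z in atTop, |T z - (A z - B z)| ≤ κ)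
    (hA : Tendsto (fun z => A z / S z) atTop (nhds l))
    (hB : Tendsto (fun z => B z / S z) atTop (nhds m)) :
    Tendsto (fun z => T z / S z) atTop (nhds (l - m)) := by
  have hrem : Tendsto (fun z => (T z - (A z - B z)) / S z) atTop (nhds 0) := by
    refine squeeze_zero_norm' ?_ (hS.const_div_atTop κ)
    filter_upwards [hT, hS.eventually_gt_atTop 0] with z hz hS0
    rw [Real.norm_eq_abs, abs_div, abs_of_pos hS0]
    gcongr
  have := hrem.add (hA.sub hB)
  rw [zero_add] at this
  refine this.congr fun z => ?_
  ring

/-- Theorem 4.11 of Eden–Viens, full tail asymptotics.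
`X` is a centered square-integrable random variable with density `ρ` positive exactly
on `(a,+∞)` (`-∞ ≤ a < 0`) and Stein factor `g(x) = (∫_x^∞ y ρ(y) dy)/ρ(x)`.
1. If `g(z)/z² → α ∈ (0,1)` as `z → ∞`, then `ln P[X>z] / ln z → -(1 + 1/α)`.
2. If `g(z)/z^p → β > 0` as `z → ∞` for some `p ∈ [0,1)`, then
   `ln P[X>z] / z^{2-p} → -1/(β(2-p))`. -/
theorem stmt_17
    (a : EReal) (ha : a < 0)
    (ρ : ℝ → ℝ)
    (hρ_meas : Measurable ρ)
    (hρ_pos : ∀ x : ℝ, 0 < ρ x ↔ a < (x : EReal))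
    (hρ_int : Integrable ρ) (hρ_one : ∫ y, ρ y = 1)
    (hmom : Integrable fun y => y * ρ y) (hcent : ∫ y, y * ρ y = 0)
    (hsq : Integrable fun y => y ^ 2 * ρ y)
    (g : ℝ → ℝ)
    (hg : ∀ x : ℝ, a < (x : EReal) → g x = (∫ y in Set.Ioi x, y * ρ y) / ρ x) :
    (∀ α : ℝ, 0 < α → α < 1 →
      Filter.Tendsto (fun z : ℝ => g z / z ^ 2) Filter.atTop (nhds α) →
      Filter.Tendsto (fun z : ℝ => Real.log (∫ y in Set.Ioi z, ρ y) / Real.log z)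
        Filter.atTop (nhds (-(1 + 1 / α)))) ∧
    (∀ β p : ℝ, 0 < β → 0 ≤ p → p < 1 →
      Filter.Tendsto (fun z : ℝ => g z / z ^ p) Filter.atTop (nhds β) →
      Filter.Tendsto (fun z : ℝ => Real.log (∫ y in Set.Ioi z, ρ y) / z ^ (2 - p))
        Filter.atTop (nhds (-(1 / (β * (2 - p)))))) := by
  have hpos : ∀ x : ℝ, 0 < x → 0 < ρ x := fun x hx =>
    (hρ_pos x).2 (ha.trans (by exact_mod_cast hx))
  have hg' : ∀ x : ℝ, 0 < x → g x = (∫ y in Ioi x, y * ρ y) / ρ x := fun x hx =>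
    hg x ((hρ_pos x).1 (hpos x hx))
  constructor
  · intro α hα _ hlim
    obtain ⟨hφ, κ, hκ⟩ := tail_asymptotics (H := Real.log) (h := fun x => x⁻¹) (β := α)
      (δ := Real.log 2) hpos hρ_int hmom hg' hα
      (fun x hx => Real.hasDerivAt_log (by linarith))
      (continuousOn_inv₀.mono fun x (hx : 1 ≤ x) => by
        simp only [mem_compl_iff, mem_singleton_iff]
        linarith)
      (fun x hx => inv_pos.2 (by linarith)) Real.tendsto_log_atTop (Real.log_pos one_lt_two)
      (fun x hx => by rw [Real.log_mul two_ne_zero (by linarith)]; linarith)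
      (hlim.congr fun z => by rw [pow_two, ← div_div, div_eq_mul_inv (g z)])
    have hone : Tendsto (fun z => Real.log z / Real.log z) atTop (nhds 1) := by
      refine tendsto_const_nhds.congr' ?_
      filter_upwards [Real.tendsto_log_atTop.eventually_gt_atTop 0] with z hz
      rw [div_self hz.ne']
    convert tendsto_div_of_abs_sub_le Real.tendsto_log_atTop hκ hφ hone using 2
    rw [one_div]
    ring
  · intro β p hβ _ hp hlim
    have hr : 0 < 2 - p := by linarith
    have hpow : Tendsto (fun z : ℝ => z ^ (2 - p)) atTop atTop := tendsto_rpow_atTop hr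
    have htwo : 1 < (2 : ℝ) ^ (2 - p) := Real.one_lt_rpow one_lt_two hr
    obtain ⟨hφ, κ, hκ⟩ := tail_asymptotics (H := fun x => x ^ (2 - p) / (2 - p))
      (h := fun x => x ^ (1 - p)) (β := β) (δ := (2 ^ (2 - p) - 1) / (2 - p))
      hpos hρ_int hmom hg' hβ
      (fun x hx => by
        refine ((Real.hasDerivAt_rpow_const (p := 2 - p) (Or.inl (by linarith))).div_const
          (2 - p)).congr_deriv ?_
        rw [show 2 - p - 1 = 1 - p by ring]
        field_simp)
      (fun x (hx : 1 ≤ x) => (Real.continuousAt_rpow_const x (1 - p)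
        (Or.inl (by linarith))).continuousWithinAt)
      (fun x hx => Real.rpow_pos_of_pos (by linarith) _)
      (hpow.atTop_div_const hr) (div_pos (by linarith) hr)
      (fun x hx => by
        have h1 : 1 ≤ x ^ (2 - p) := Real.one_le_rpow hx hr.le
        rw [Real.mul_rpow zero_le_two (by linarith), ← sub_div]
        exact div_le_div_of_nonneg_right (by nlinarith) hr.le)
      (hlim.congr' (by
        filter_upwards [eventually_gt_atTop 0] with z hz
        rw [Real.rpow_sub hz, Real.rpow_one]
        have := Real.rpow_pos_of_pos hz p
        field_simp))
    have hφ' : Tendsto (fun z => Real.log (∫ y in Ioi z, y * ρ y) / z ^ (2 - p)) atTop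
        (nhds (-β⁻¹ / (2 - p))) := by
      refine (hφ.div_const (2 - p)).congr fun z => ?_
      rw [div_div, div_mul_cancel₀ _ hr.ne']
    convert tendsto_div_of_abs_sub_le hpow hκ hφ'
      (isLittleO_log_rpow_atTop hr).tendsto_div_nhds_zero using 2
    field_simp
    ring
end

section
/- If α ≤ 0, then E[|Z|^m] < ∞ for every m > 0. If α > 0, then for m > 0 one has E[|Z|^m] < ∞ if and only if m < 1 + 1/α. -/
open MeasureTheory Filter Set
open scoped Topology

/-- The tail of the first moment of `ρ`, that is `z ↦ ∫_z^∞ y ρ(y) dy`. -/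
noncomputable def firstMomentTail (ρ : ℝ → ℝ) (z : ℝ) : ℝ := ∫ y in Ioi z, y * ρ y

/-- A continuous centered function, positive exactly on `(a, b)`, whose Stein factor is the
quadratic polynomial `α z² + β z + γ`. -/
structure IsCenteredPearson (a b : EReal) (α β γ : ℝ) (ρ : ℝ → ℝ) : Prop where
  left_neg : a < 0
  right_pos : 0 < b
  cont : Continuous ρ
  pos_iff : ∀ x : ℝ, 0 < ρ x ↔ (a < (x : EReal) ∧ (x : EReal) < b)
  integrable : Integrable ρ
  integrable_mul : Integrable fun y => y * ρ y
  centered : ∫ y, y * ρ y = 0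
  tail_eq : ∀ z : ℝ, a < (z : EReal) → (z : EReal) < b →
    firstMomentTail ρ z = (α * z ^ 2 + β * z + γ) * ρ z

/-- A quadratic polynomial with positive leading coefficient is eventually nonnegative. -/
lemma exists_forall_quadratic_nonneg {c : ℝ} (hc : 0 < c) (d e : ℝ) :
    ∃ R, 1 ≤ R ∧ ∀ z, R ≤ z → 0 ≤ c * z ^ 2 + d * z + e := by
  have h0 : 0 ≤ (|d| + |e|) / c := by positivity
  refine ⟨1 + (|d| + |e|) / c, by linarith, fun z hz => ?_⟩
  have hz1 : 1 ≤ z := by linarith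
  have h1 : |d| + |e| ≤ c * z := by
    have := (div_le_iff₀ hc).1 (show (|d| + |e|) / c ≤ z by linarith)
    linarith
  have h2 := neg_abs_le d
  have h3 := neg_abs_le e
  nlinarith [abs_nonneg d, abs_nonneg e, mul_nonneg (sub_nonneg.2 h1) (by linarith : 0 ≤ z),
    mul_nonneg (by linarith : 0 ≤ d + |d|) (by linarith : 0 ≤ z),
    mul_nonneg (abs_nonneg e) (by linarith : 0 ≤ z - 1)]

/-- A function bounded below with nonpositive derivative on a half-line has integrable
derivative there. -/
lemma integrableOn_Ioi_deriv_of_nonpos_of_bddBelow {F F' : ℝ → ℝ} {R l : ℝ}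
    (hF : ∀ x ∈ Ici R, HasDerivAt F (F' x) x) (hF' : ∀ x ∈ Ici R, F' x ≤ 0)
    (hl : ∀ x ∈ Ici R, l ≤ F x) : IntegrableOn F' (Ioi R) := by
  have hanti : AntitoneOn F (Ici R) := by
    refine antitoneOn_of_hasDerivWithinAt_nonpos (f' := F') (convex_Ici R)
      (fun x hx => (hF x hx).continuousAt.continuousWithinAt) (fun x hx => ?_) (fun x hx => ?_)
    · exact (hF x (interior_subset hx)).hasDerivWithinAt
    · exact hF' x (interior_subset hx)
  have hanti' : Antitone fun x => F (max x R) := fun x y hxy =>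
    hanti (le_max_right x R) (le_max_right y R) (max_le_max_right R hxy)
  have hlim : Tendsto F atTop (𝓝 (⨅ x, F (max x R))) := by
    refine (tendsto_atTop_ciInf hanti' ⟨l, ?_⟩).congr' ?_
    · rintro _ ⟨x, rfl⟩
      exact hl _ (le_max_right x R)
    · filter_upwards [eventually_ge_atTop R] with x hx
      rw [max_eq_left hx]
  exact integrableOn_Ioi_deriv_of_nonpos' hF (fun x hx => hF' x (Ioi_subset_Ici_self hx)) hlim

namespace IsCenteredPearson

variable {a b : EReal} {α β γ : ℝ} {ρ : ℝ → ℝ}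

lemma reflect (h : IsCenteredPearson a b α β γ ρ) :
    IsCenteredPearson (-b) (-a) α (-β) γ fun x => ρ (-x) where
  left_neg := by simpa using EReal.neg_lt_neg_iff.2 h.right_pos
  right_pos := by simpa using EReal.neg_lt_neg_iff.2 h.left_neg
  cont := h.cont.comp continuous_neg
  pos_iff x := by
    rw [h.pos_iff, EReal.coe_neg, EReal.lt_neg_comm, EReal.neg_lt_comm, and_comm]
  integrable := h.integrable.comp_neg
  integrable_mul := by simpa using h.integrable_mul.comp_neg.neg
  centered := by
    have := integral_neg_eq_self (fun y => y * ρ y) volume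
    rw [h.centered] at this
    simpa [integral_neg] using this
  tail_eq z hz₁ hz₂ := by
    have h1 : firstMomentTail (fun x => ρ (-x)) z = firstMomentTail ρ (-z) := by
      have e1 := integral_comp_neg_Ioi z (fun y => y * ρ y)
      have e2 := intervalIntegral.integral_Iic_add_Ioi (b := -z) h.integrable_mul.integrableOn
        h.integrable_mul.integrableOn
      rw [h.centered] at e2
      simp only [neg_mul, integral_neg] at e1
      simp only [firstMomentTail]
      linarith
    rw [h1, h.tail_eq (-z) (by rw [EReal.coe_neg]; exact EReal.lt_neg_comm.1 hz₂)
      (by rw [EReal.coe_neg]; exact EReal.neg_lt_comm.1 hz₁)]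
    ring

lemma hasDerivAt_tail (h : IsCenteredPearson a b α β γ ρ) (z : ℝ) :
    HasDerivAt (firstMomentTail ρ) (-(z * ρ z)) z := by
  have hc : Continuous fun y => y * ρ y := continuous_id.mul h.cont
  have h1 : firstMomentTail ρ = fun z => firstMomentTail ρ 0 - ∫ y in (0 : ℝ)..z, y * ρ y := by
    funext z
    have := intervalIntegral.integral_Ioi_sub_Ioi' (a := 0) (b := z)
      h.integrable_mul.integrableOn h.integrable_mul.integrableOn
    simp only [firstMomentTail]
    linarith
  rw [h1]
  exact (hc.integral_hasStrictDerivAt 0 z).hasDerivAt.const_sub _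

lemma continuous_tail (h : IsCenteredPearson a b α β γ ρ) : Continuous (firstMomentTail ρ) :=
  continuous_iff_continuousAt.2 fun z => (h.hasDerivAt_tail z).continuousAt

lemma left_lt_of_nonneg (h : IsCenteredPearson a b α β γ ρ) {z : ℝ} (hz : 0 ≤ z) :
    a < (z : EReal) :=
  h.left_neg.trans_le (by exact_mod_cast hz)

/-- At a finite right endpoint the density vanishes. -/
lemma eq_zero_right {b : ℝ} (h : IsCenteredPearson a b α β γ ρ) : ρ b = 0 := by
  have hb : 0 < b := by exact_mod_cast h.right_pos
  refine le_antisymm (not_lt.1 fun hp => lt_irrefl _ ((h.pos_iff b).1 hp).2) ?_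
  refine ge_of_tendsto (h.cont.continuousAt.tendsto.mono_left nhdsWithin_le_nhds :
    Tendsto ρ (𝓝[<] b) (𝓝 (ρ b))) ?_
  filter_upwards [Ioo_mem_nhdsLT hb] with x hx
  exact ((h.pos_iff x).2 ⟨h.left_lt_of_nonneg hx.1.le, by exact_mod_cast hx.2⟩).le

lemma tail_eq_right {b : ℝ} (h : IsCenteredPearson a b α β γ ρ) : firstMomentTail ρ b = 0 := by
  have hb : 0 < b := by exact_mod_cast h.right_pos
  have hg : Continuous fun z : ℝ => (α * z ^ 2 + β * z + γ) * ρ z :=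
    (by fun_prop : Continuous fun z : ℝ => α * z ^ 2 + β * z + γ).mul h.cont
  have h1 : Tendsto (firstMomentTail ρ) (𝓝[<] b) (𝓝 (firstMomentTail ρ b)) :=
    h.continuous_tail.continuousAt.tendsto.mono_left nhdsWithin_le_nhds
  have h2 : Tendsto (fun z : ℝ => (α * z ^ 2 + β * z + γ) * ρ z) (𝓝[<] b)
      (𝓝 ((α * b ^ 2 + β * b + γ) * ρ b)) :=
    hg.continuousAt.tendsto.mono_left nhdsWithin_le_nhds
  rw [h.eq_zero_right, mul_zero] at h2
  refine tendsto_nhds_unique h1 (h2.congr' ?_)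
  filter_upwards [Ioo_mem_nhdsLT hb] with x hx
  exact (h.tail_eq x (h.left_lt_of_nonneg hx.1.le) (by exact_mod_cast hx.2)).symm

lemma eq_zero_of_right_lt {b : ℝ} (h : IsCenteredPearson a b α β γ ρ) {x : ℝ} (hx : b < x) :
    ρ x = 0 := by
  have hb : 0 < b := by exact_mod_cast h.right_pos
  have hnonpos : ∀ y, b < y → ρ y ≤ 0 := fun y hy => not_lt.1 fun hp =>
    absurd ((h.pos_iff y).1 hp).2 (not_lt.2 (by exact_mod_cast hy.le))
  have hint : ∫ y in Ioi b, -(y * ρ y) = 0 := by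
    rw [integral_neg]
    simpa [firstMomentTail] using h.tail_eq_right
  have hae := (setIntegral_eq_zero_iff_of_nonneg_ae
    (ae_restrict_of_forall_mem measurableSet_Ioi fun y (hy : b < y) => by
      have := mul_nonneg (hb.trans hy).le (neg_nonneg.2 (hnonpos y hy))
      simpa using this) h.integrable_mul.neg.integrableOn).1 hint
  have heq := Measure.eqOn_open_of_ae_eq hae isOpen_Ioi
    (continuous_id.mul h.cont).neg.continuousOn continuousOn_const hx
  have : x * ρ x = 0 := by simpa using heq
  exact (mul_eq_zero.1 this).resolve_left (hb.trans hx).ne'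

lemma nonneg_of_nonneg (h : IsCenteredPearson a b α β γ ρ) {x : ℝ} (hx : 0 ≤ x) : 0 ≤ ρ x := by
  by_cases hxb : (x : EReal) < b
  · exact ((h.pos_iff x).2 ⟨h.left_lt_of_nonneg hx, hxb⟩).le
  · rw [not_lt] at hxb
    lift b to ℝ using ⟨(hxb.trans_lt (EReal.coe_lt_top x)).ne,
      (EReal.bot_lt_zero.trans h.right_pos).ne'⟩
    rcases (EReal.coe_le_coe_iff.1 hxb).eq_or_lt with rfl | hlt
    · exact h.eq_zero_right.ge
    · exact (h.eq_zero_of_right_lt hlt).ge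

lemma nonneg (h : IsCenteredPearson a b α β γ ρ) (x : ℝ) : 0 ≤ ρ x := by
  rcases le_total 0 x with hx | hx
  · exact h.nonneg_of_nonneg hx
  · simpa using h.reflect.nonneg_of_nonneg (neg_nonneg.2 hx)

lemma tail_nonneg (h : IsCenteredPearson a b α β γ ρ) {z : ℝ} (hz : 0 ≤ z) :
    0 ≤ firstMomentTail ρ z :=
  setIntegral_nonneg measurableSet_Ioi fun y (hy : z < y) =>
    mul_nonneg (hz.trans hy.le) (h.nonneg y)

lemma factor_pos (h : IsCenteredPearson a b α β γ ρ) {z : ℝ} (hz : 0 ≤ z)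
    (hzb : (z : EReal) < b) : 0 < α * z ^ 2 + β * z + γ := by
  have hρ : 0 < ρ z := (h.pos_iff z).2 ⟨h.left_lt_of_nonneg hz, hzb⟩
  refine pos_of_mul_pos_left ?_ hρ.le
  rw [← h.tail_eq z (h.left_lt_of_nonneg hz) hzb]
  obtain ⟨w, hzw, hwb⟩ := EReal.lt_iff_exists_real_btwn.1 hzb
  have hzw' : z < w := by exact_mod_cast hzw
  refine (setIntegral_pos_iff_support_of_nonneg_ae
    (ae_restrict_of_forall_mem measurableSet_Ioi fun y (hy : z < y) =>
      mul_nonneg (hz.trans hy.le) (h.nonneg y)) h.integrable_mul.integrableOn).2 ?_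
  have hsub : Ioo z w ⊆ (Function.support fun y => y * ρ y) ∩ Ioi z := fun y hy =>
    ⟨(mul_pos (hz.trans_lt hy.1) ((h.pos_iff y).2 ⟨h.left_lt_of_nonneg (hz.trans hy.1.le),
      lt_trans (by exact_mod_cast hy.2) hwb⟩)).ne', hy.1⟩
  exact lt_of_lt_of_le (by simpa using hzw') (measure_mono hsub)

/-- The Stein factor vanishes at a finite right endpoint. -/
lemma factor_right_eq_zero {b : ℝ} (h : IsCenteredPearson a b α β γ ρ) :
    α * b ^ 2 + β * b + γ = 0 := by
  have hb : 0 < b := by exact_mod_cast h.right_pos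
  have hg : Continuous fun z : ℝ => α * z ^ 2 + β * z + γ := by fun_prop
  by_contra hne
  have hgb : 0 ≤ α * b ^ 2 + β * b + γ := by
    refine ge_of_tendsto (hg.continuousAt.tendsto.mono_left nhdsWithin_le_nhds :
      Tendsto _ (𝓝[<] b) (𝓝 (α * b ^ 2 + β * b + γ))) ?_
    filter_upwards [Ioo_mem_nhdsLT hb] with x hx
    exact (h.factor_pos hx.1.le (by exact_mod_cast hx.2)).le
  obtain ⟨w, hw, hmin⟩ := isCompact_Icc.exists_isMinOn (nonempty_Icc.2 hb.le) hg.continuousOn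
  set c := α * w ^ 2 + β * w + γ with hc_def
  have hc : 0 < c := by
    rcases hw.2.eq_or_lt with rfl | hlt
    · exact lt_of_le_of_ne hgb (Ne.symm hne)
    · exact h.factor_pos hw.1 (by exact_mod_cast hlt)
  have hder : ∀ z, HasDerivAt (fun z => Real.exp (b / c * z) * firstMomentTail ρ z)
      (Real.exp (b / c * z) * (b / c) * firstMomentTail ρ z
        + Real.exp (b / c * z) * -(z * ρ z)) z := fun z =>
    (((hasDerivAt_id z).const_mul (b / c)).exp.congr_deriv (by simp)).mul (h.hasDerivAt_tail z)
  have hmono : MonotoneOn (fun z => Real.exp (b / c * z) * firstMomentTail ρ z) (Icc 0 b) := by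
    refine monotoneOn_of_hasDerivWithinAt_nonneg (convex_Icc 0 b)
      (fun x _ => (hder x).continuousAt.continuousWithinAt)
      (fun x _ => (hder x).hasDerivWithinAt) fun x hx => ?_
    rw [interior_Icc] at hx
    rw [h.tail_eq x (h.left_lt_of_nonneg hx.1.le) (by exact_mod_cast hx.2)]
    have hcx : c ≤ α * x ^ 2 + β * x + γ := hmin (Ioo_subset_Icc_self hx)
    have h1 : x ≤ b / c * (α * x ^ 2 + β * x + γ) :=
      calc x ≤ b := hx.2.le
        _ = b / c * c := by field_simp
        _ ≤ _ := by gcongr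
    have h2 := mul_nonneg (mul_nonneg (Real.exp_pos (b / c * x)).le (h.nonneg x))
      (sub_nonneg.2 h1)
    linarith
  have hle := hmono (left_mem_Icc.2 hb.le) (right_mem_Icc.2 hb.le) hb.le
  have h0b : ((0 : ℝ) : EReal) < b := by exact_mod_cast hb
  have h0 : 0 < firstMomentTail ρ 0 := by
    rw [h.tail_eq 0 (h.left_lt_of_nonneg le_rfl) h0b]
    exact mul_pos (h.factor_pos le_rfl h0b) ((h.pos_iff 0).2 ⟨h.left_lt_of_nonneg le_rfl, h0b⟩)
  simp only [mul_zero, Real.exp_zero, one_mul, h.tail_eq_right] at hle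
  exact absurd hle (not_le.2 h0)

/-- With positive leading coefficient, the support is unbounded. -/
lemma left_eq_bot_or_right_eq_top (h : IsCenteredPearson a b α β γ ρ) (hα : 0 < α) :
    a = ⊥ ∨ b = ⊤ := by
  by_contra! hab
  lift b to ℝ using ⟨hab.2, (EReal.bot_lt_zero.trans h.right_pos).ne'⟩
  lift a to ℝ using ⟨(h.left_neg.trans EReal.zero_lt_top).ne, hab.1⟩
  have hb : 0 < b := by exact_mod_cast h.right_pos
  have ha : a < 0 := by exact_mod_cast h.left_neg
  have h1 := h.factor_right_eq_zero
  have h' := h.reflect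
  rw [← EReal.coe_neg a] at h'
  have h2 := h'.factor_right_eq_zero
  have hγ := h.factor_pos le_rfl (by exact_mod_cast hb)
  have h3 : (b - a) * (γ - α * a * b) = 0 := by linear_combination (-a) * h1 + b * h2
  have h4 : 0 < α * (-a) * b := mul_pos (mul_pos hα (neg_pos.2 ha)) hb
  have h5 : 0 < (b - a) * (γ - α * a * b) := mul_pos (by linarith) (by linarith)
  exact h5.ne' h3

lemma continuous_moment (h : IsCenteredPearson a b α β γ ρ) {m : ℝ} (hm : 0 ≤ m) :
    Continuous fun z : ℝ => |z| ^ m * ρ z :=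
  (continuous_abs.rpow_const fun _ => Or.inr hm).mul h.cont

lemma integrableOn_Ioi_of_right_eq_top (h : IsCenteredPearson a ⊤ α β γ ρ) {m : ℝ} (hm : 0 < m)
    (hmα : (m - 1) * α < 1) : ∃ R, 0 ≤ R ∧ IntegrableOn (fun z : ℝ => |z| ^ m * ρ z) (Ioi R) := by
  set ε := (1 - (m - 1) * α) / 2 with hε_def
  have hε : 0 < ε := by rw [hε_def]; linarith
  obtain ⟨R, hR1, hR⟩ := exists_forall_quadratic_nonneg hε (-((m - 1) * β)) (-((m - 1) * γ))
  refine ⟨R, by linarith, ?_⟩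
  have hkey : ∀ z ∈ Ici R, (m - 1) * z ^ (m - 1 - 1) * firstMomentTail ρ z
      + z ^ (m - 1) * -(z * ρ z) ≤ -ε * (|z| ^ m * ρ z) := by
    intro z (hz : R ≤ z)
    have hz0 : 0 < z := by linarith
    have e1 : z ^ (m - 1) = z ^ (m - 1 - 1) * z := by
      rw [← Real.rpow_add_one hz0.ne']; ring_nf
    have e2 : z ^ m = z ^ (m - 1 - 1) * z ^ 2 := by
      rw [← Real.rpow_natCast z 2, ← Real.rpow_add hz0]; ring_nf
    rw [abs_of_pos hz0, h.tail_eq z (h.left_lt_of_nonneg hz0.le) (EReal.coe_lt_top z), e2, e1]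
    have h1 := mul_nonneg (mul_nonneg (Real.rpow_pos_of_pos hz0 (m - 1 - 1)).le (h.nonneg z))
      (hR z hz)
    have h2 : 1 - (m - 1) * α = 2 * ε := by rw [hε_def]; ring
    have h3 : (m - 1) * α = 1 - 2 * ε := by linarith
    linear_combination h1 + z ^ (m - 1 - 1) * ρ z * z ^ 2 * h3
  have hnn : ∀ z, 0 ≤ |z| ^ m * ρ z := fun z =>
    mul_nonneg (Real.rpow_nonneg (abs_nonneg z) m) (h.nonneg z)
  have hint := integrableOn_Ioi_deriv_of_nonpos_of_bddBelow (R := R) (l := 0)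
    (F := fun z => z ^ (m - 1) * firstMomentTail ρ z)
    (fun z (hz : R ≤ z) => (Real.hasDerivAt_rpow_const (Or.inl (by linarith))).mul
      (h.hasDerivAt_tail z))
    (fun z hz => (hkey z hz).trans (by nlinarith [hnn z]))
    (fun z (hz : R ≤ z) => mul_nonneg (Real.rpow_nonneg (by linarith) _)
      (h.tail_nonneg (by linarith)))
  refine Integrable.mono' (hint.neg.const_mul ε⁻¹)
    (h.continuous_moment hm.le).aestronglyMeasurable ?_
  refine ae_restrict_of_forall_mem measurableSet_Ioi fun z (hz : R < z) => ?_
  rw [Real.norm_of_nonneg (hnn z), ← div_eq_inv_mul, le_div_iff₀ hε]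
  have := hkey z hz.le
  simp only [Pi.neg_apply]
  linarith

lemma integrableOn_Ioi_zero (h : IsCenteredPearson a b α β γ ρ) {m : ℝ} (hm : 0 < m)
    (hmα : (m - 1) * α < 1) : IntegrableOn (fun z : ℝ => |z| ^ m * ρ z) (Ioi 0) := by
  obtain ⟨R, hR0, hR⟩ : ∃ R, 0 ≤ R ∧ IntegrableOn (fun z : ℝ => |z| ^ m * ρ z) (Ioi R) := by
    by_cases hb : b = ⊤
    · subst hb
      exact h.integrableOn_Ioi_of_right_eq_top hm hmα
    · lift b to ℝ using ⟨hb, (EReal.bot_lt_zero.trans h.right_pos).ne'⟩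
      refine ⟨b, by exact_mod_cast h.right_pos.le, ?_⟩
      refine integrableOn_zero.congr_fun (fun z hz => ?_) measurableSet_Ioi
      simp [h.eq_zero_of_right_lt hz]
  rw [← Ioc_union_Ioi_eq_Ioi hR0]
  exact (((h.continuous_moment hm.le).integrableOn_Icc).mono_set Ioc_subset_Icc_self).union hR

lemma integrable_moment (h : IsCenteredPearson a b α β γ ρ) {m : ℝ} (hm : 0 < m)
    (hmα : (m - 1) * α < 1) : Integrable fun z : ℝ => |z| ^ m * ρ z := by
  have h1 := h.integrableOn_Ioi_zero hm hmα
  have h2 := h.reflect.integrableOn_Ioi_zero hm hmα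
  have h3 : IntegrableOn (fun z : ℝ => |z| ^ m * ρ z) (Iio 0) := by
    rw [← neg_zero] at h2
    simpa using h2.comp_neg_Iio
  rw [← integrableOn_univ, ← Iic_union_Ioi (a := (0 : ℝ))]
  exact (IntegrableOn.congr_set_ae h3 Iio_ae_eq_Iic.symm).union h1

lemma integrable_moment_of_le_one (h : IsCenteredPearson a b α β γ ρ) {m : ℝ} (hm : 0 < m)
    (hm1 : m ≤ 1) : Integrable fun z : ℝ => |z| ^ m * ρ z := by
  refine (h.integrable.add h.integrable_mul.norm).mono'
    (h.continuous_moment hm.le).aestronglyMeasurable (ae_of_all _ fun z => ?_)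
  have hρ := h.nonneg z
  rw [Real.norm_of_nonneg (mul_nonneg (Real.rpow_nonneg (abs_nonneg z) m) hρ)]
  simp only [Pi.add_apply, norm_mul, Real.norm_eq_abs, abs_of_nonneg hρ]
  have h1 : |z| ^ m ≤ 1 + |z| := by
    rcases le_total |z| 1 with hz | hz
    · linarith [Real.rpow_le_one (abs_nonneg z) hz hm.le, abs_nonneg z]
    · have := Real.rpow_le_rpow_of_exponent_le hz hm1
      rw [Real.rpow_one] at this
      linarith
  nlinarith [mul_le_mul_of_nonneg_right h1 hρ]

/-- On an unbounded right tail, `firstMomentTail ρ` decays no faster than `z ^ (-1 / α)`. -/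
lemma exists_le_rpow_mul_tail (h : IsCenteredPearson a ⊤ α β γ ρ) (hα : 0 < α) :
    ∃ R c, 1 ≤ R ∧ 0 < c ∧ ∀ z, R ≤ z → c ≤ z ^ (1 / α) * firstMomentTail ρ z := by
  set p := 1 / α with hp_def
  have hp : 0 < p := by positivity
  have hpα : p * α = 1 := by rw [hp_def]; field_simp
  set k := |p * β| + 1 with hk_def
  have hk : 0 < k := by positivity
  set R := k + 1 + |p * γ| with hR_def
  have hkR : k < R := by rw [hR_def]; linarith [abs_nonneg (p * γ)]
  have hR1 : 1 ≤ R := by rw [hR_def]; linarith [abs_nonneg (p * γ)]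
  have hlin : ∀ z, R ≤ z → 0 ≤ (p * β + k) * z + p * γ := by
    intro z hz
    have h1 : 1 ≤ p * β + k := by rw [hk_def]; linarith [neg_abs_le (p * β)]
    have h2 : |p * γ| ≤ z := by linarith
    nlinarith [neg_abs_le (p * γ), mul_nonneg (sub_nonneg.2 h1) (by linarith : 0 ≤ z)]
  have hder : ∀ z, R ≤ z → HasDerivAt (fun z => (z - k) ^ p * firstMomentTail ρ z)
      (p * (z - k) ^ (p - 1) * firstMomentTail ρ z + (z - k) ^ p * -(z * ρ z)) z := fun z hz =>
    ((((hasDerivAt_id z).sub_const k).rpow_const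
      (Or.inl (by simp only [id]; linarith))).congr_deriv (by simp)).mul (h.hasDerivAt_tail z)
  have hmono : MonotoneOn (fun z => (z - k) ^ p * firstMomentTail ρ z) (Ici R) := by
    refine monotoneOn_of_hasDerivWithinAt_nonneg (convex_Ici R)
      (fun x hx => (hder x hx).continuousAt.continuousWithinAt)
      (fun x hx => (hder x (interior_subset hx)).hasDerivWithinAt) fun x hx => ?_
    have hx' : R ≤ x := interior_subset hx
    have hxk : 0 < x - k := by linarith
    have e1 : (x - k) ^ p = (x - k) ^ (p - 1) * (x - k) := by
      rw [← Real.rpow_add_one hxk.ne']; ring_nf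
    rw [h.tail_eq x (h.left_lt_of_nonneg (by linarith)) (EReal.coe_lt_top x), e1]
    have h1 := mul_nonneg (mul_nonneg (Real.rpow_pos_of_pos hxk (p - 1)).le (h.nonneg x))
      (hlin x hx')
    linear_combination h1 + (x - k) ^ (p - 1) * ρ x * x ^ 2 * (-hpα)
  have hR0 : 0 ≤ R := by linarith
  refine ⟨R, (R - k) ^ p * firstMomentTail ρ R, hR1, ?_, fun z hz => ?_⟩
  · rw [h.tail_eq R (h.left_lt_of_nonneg hR0) (EReal.coe_lt_top R)]
    exact mul_pos (Real.rpow_pos_of_pos (by linarith) p)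
      (mul_pos (h.factor_pos hR0 (EReal.coe_lt_top R))
        ((h.pos_iff R).2 ⟨h.left_lt_of_nonneg hR0, EReal.coe_lt_top R⟩))
  · refine (hmono (mem_Ici.2 le_rfl) (mem_Ici.2 hz) hz).trans ?_
    exact mul_le_mul_of_nonneg_right
      (Real.rpow_le_rpow (by linarith) (by linarith) hp.le) (h.tail_nonneg (by linarith))

lemma not_integrable_of_right_eq_top (h : IsCenteredPearson a ⊤ α β γ ρ) (hα : 0 < α) {m : ℝ}
    (hm : 1 + 1 / α ≤ m) : ¬ Integrable fun z : ℝ => |z| ^ m * ρ z := by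
  intro hint
  obtain ⟨R, c, hR1, hc, hR⟩ := h.exists_le_rpow_mul_tail hα
  set C := α + |β| + |γ| with hC_def
  have hC : 0 < C := by positivity
  refine not_integrableOn_Ioi_inv (a := R) ?_
  refine Integrable.mono' ((hint.integrableOn (s := Ioi R)).const_mul (C / c))
    measurable_inv.aestronglyMeasurable ?_
  refine ae_restrict_of_forall_mem measurableSet_Ioi fun z (hz : R < z) => ?_
  have hz1 : 1 ≤ z := by linarith
  have hz0 : 0 < z := by linarith
  have hρ := h.nonneg z
  have hg : α * z ^ 2 + β * z + γ ≤ C * z ^ 2 := by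
    rw [hC_def]
    nlinarith [le_abs_self β, le_abs_self γ, abs_nonneg β, abs_nonneg γ,
      mul_le_mul_of_nonneg_right (le_abs_self β) hz0.le,
      mul_nonneg (abs_nonneg β) (mul_nonneg hz0.le (sub_nonneg.2 hz1)),
      mul_nonneg (abs_nonneg γ) (by nlinarith : 0 ≤ z ^ 2 - 1)]
  have h1 := hR z hz.le
  rw [h.tail_eq z (h.left_lt_of_nonneg hz0.le) (EReal.coe_lt_top z)] at h1
  have hpow : z ^ (1 / α) * z ≤ z ^ m := by
    rw [← Real.rpow_add_one hz0.ne']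
    exact Real.rpow_le_rpow_of_exponent_le hz1 (by linarith)
  have hzp : 0 ≤ z ^ (1 / α) := Real.rpow_nonneg hz0.le _
  have h2 : c ≤ C * z * (z ^ m * ρ z) :=
    calc c ≤ z ^ (1 / α) * ((α * z ^ 2 + β * z + γ) * ρ z) := h1
      _ ≤ z ^ (1 / α) * (C * z ^ 2 * ρ z) := by gcongr
      _ = C * z * (z ^ (1 / α) * z * ρ z) := by ring
      _ ≤ C * z * (z ^ m * ρ z) := by gcongr
  rw [Real.norm_of_nonneg (inv_nonneg.2 hz0.le), abs_of_pos hz0, inv_eq_one_div,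
    div_le_iff₀ hz0, div_mul_eq_mul_div, div_mul_eq_mul_div, le_div_iff₀ hc]
  linarith

lemma not_integrable_moment (h : IsCenteredPearson a b α β γ ρ) (hα : 0 < α) {m : ℝ}
    (hm : 1 + 1 / α ≤ m) : ¬ Integrable fun z : ℝ => |z| ^ m * ρ z := by
  rcases h.left_eq_bot_or_right_eq_top hα with rfl | rfl
  · intro hint
    have h' := h.reflect
    rw [EReal.neg_bot] at h'
    exact h'.not_integrable_of_right_eq_top hα hm (by simpa using hint.comp_neg)
  · exact h.not_integrable_of_right_eq_top hα hm

end IsCenteredPearson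

/-- Lemma 5.2 of Eden–Viens, moments of Pearson distributions.
`Z` is a centered Pearson random variable: its density `ρ` is continuous on `ℝ`,
positive exactly on `(a,b)`, differentiable there, and its Stein factor satisfies
`g(z) = α z² + β z + γ` on `(a,b)`.  Then: if `α ≤ 0`, `E[|Z|^m] < ∞` for every
`m > 0`; and if `α > 0`, then for `m > 0`, `E[|Z|^m] < ∞` iff `m < 1 + 1/α`. -/
theorem stmt_19
    (a b : EReal) (ha : a < 0) (hb : 0 < b) (α β γ : ℝ)
    (ρ : ℝ → ℝ)
    (hρ_cont : Continuous ρ)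
    (hρ_pos : ∀ x : ℝ, 0 < ρ x ↔ (a < (x : EReal) ∧ (x : EReal) < b))
    (hρ_diff : ∀ x : ℝ, a < (x : EReal) → (x : EReal) < b → DifferentiableAt ℝ ρ x)
    (hρ_int : Integrable ρ)
    (hρ_one : ∫ y, ρ y = 1)
    (hmom : Integrable fun y => y * ρ y)
    (hcent : ∫ y, y * ρ y = 0)
    (hPearson : ∀ z : ℝ, a < (z : EReal) → (z : EReal) < b →
      (∫ y in Set.Ioi z, y * ρ y) / ρ z = α * z ^ 2 + β * z + γ) :
    (α ≤ 0 → ∀ m : ℝ, 0 < m → Integrable (fun z : ℝ => |z| ^ m * ρ z)) ∧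
    (0 < α → ∀ m : ℝ, 0 < m →
      (Integrable (fun z : ℝ => |z| ^ m * ρ z) ↔ m < 1 + 1 / α)) := by
  have h : IsCenteredPearson a b α β γ ρ :=
    { left_neg := ha
      right_pos := hb
      cont := hρ_cont
      pos_iff := hρ_pos
      integrable := hρ_int
      integrable_mul := hmom
      centered := hcent
      tail_eq := fun z hz₁ hz₂ =>
        (div_eq_iff ((hρ_pos z).2 ⟨hz₁, hz₂⟩).ne').1 (hPearson z hz₁ hz₂) }
  refine ⟨fun hα m hm => ?_, fun hα m hm => ⟨fun hint => ?_, fun hlt => ?_⟩⟩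
  · rcases le_total m 1 with hm1 | hm1
    · exact h.integrable_moment_of_le_one hm hm1
    · exact h.integrable_moment hm (by nlinarith)
  · by_contra! hle
    exact h.not_integrable_moment hα hle hint
  · refine h.integrable_moment hm ?_
    rw [← lt_div_iff₀ hα]
    linarith
end
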